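/- arXiv:1412.5569 — 2 statements merged into one kernel-verified Lean document; each statement's English description precedes it below -/
import Mathlib

section
/- Let d ≥ 2 be an integer and let 0 < γ ≤ 1, 0 < λ ≤ 1 be real numbers. There exists a constant c > 0 depending only on d, γ, λ such that: for every finite field F, every n, every real β with max(1-d, -1) ≤ β ≤ 1, every collection L of lines in F^n with |L| ≥ γ · |F|^{2(d-1)+β} that satisfies the d-plane Wolff axiom, and every collection P of points in F^n satisfying |{x ∈ P : x ∈ ℓ}| ≥ λ · |F| for every line ℓ ∈ L, one has |P| ≥ c · |F|^{d + (β+1)/2}. -/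
open scoped Pointwise

/-- `A` is a `k`-plane (i.e. a `k`-dimensional affine subspace) of the `F`-vector space `V`. -/
def IsPlane (F : Type*) [Field F] {V : Type*} [AddCommGroup V] [Module F V]
    (k : ℕ) (A : Set V) : Prop :=
  ∃ (x : V) (W : Submodule F V), Module.finrank F W = k ∧ A = x +ᵥ (W : Set V)


/-- A collection `L` of lines in `Fⁿ` satisfies the `d`-plane Wolff axiom if every
`d`-plane contains strictly fewer than `|F|^(2d-3)` lines of `L`. -/
def DPlaneWolffAxiom (F : Type) [Field F] [Fintype F] {n : ℕ} (d : ℕ)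
    (L : Set (Set (Fin n → F))) : Prop :=
  ∀ R : Set (Fin n → F), IsPlane F d R →
    {ℓ ∈ L | ℓ ⊆ R}.ncard < Fintype.card F ^ (2 * d - 3)

section Planes

variable {F V : Type*} [Field F] [AddCommGroup V] [Module F V]

/-- A plane through `y` is the translate by `y` of a linear subspace. -/
lemma IsPlane.exists_submodule {k : ℕ} {A : Set V} (h : IsPlane F k A) {y : V} (hy : y ∈ A) :
    ∃ W : Submodule F V, Module.finrank F W = k ∧ ∀ z, z ∈ A ↔ z - y ∈ W := by
  obtain ⟨x, W, hW, rfl⟩ := h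
  refine ⟨W, hW, fun z => ?_⟩
  rw [Set.mem_vadd_set_iff_neg_vadd_mem] at hy ⊢
  simp only [vadd_eq_add, SetLike.mem_coe] at hy ⊢
  rw [← W.add_mem_iff_left hy (x := z - y)]
  congr! 1
  abel

lemma isPlane_of_mem_iff {k : ℕ} {A : Set V} {y : V} {W : Submodule F V}
    (hW : Module.finrank F W = k) (hA : ∀ z, z ∈ A ↔ z - y ∈ W) : IsPlane F k A := by
  refine ⟨y, W, hW, ?_⟩
  ext z
  rw [hA, Set.mem_vadd_set_iff_neg_vadd_mem, vadd_eq_add, SetLike.mem_coe, neg_add_eq_sub]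

/-- A line meeting a `k`-plane in a single point spans with it a `(k+1)`-plane. -/
lemma IsPlane.exists_span [Finite V] {k : ℕ} {A l : Set V} (hA : IsPlane F k A)
    (hl : IsPlane F 1 l) (h : ¬ l ⊆ A) (hne : (l ∩ A).Nonempty) :
    ∃ R : Set V, IsPlane F (k + 1) R ∧ A ⊆ R ∧ l ⊆ R := by
  obtain ⟨y, hyl, hyA⟩ := hne
  obtain ⟨W, hW, hWA⟩ := hA.exists_submodule hyA
  obtain ⟨U, hU, hUl⟩ := hl.exists_submodule hyl
  have hlt : W ⊓ U < U := by
    refine lt_of_le_of_ne inf_le_right fun he => h fun z hz => ?_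
    exact (hWA z).2 (inf_eq_right.1 he ((hUl z).1 hz))
  have hfr := Submodule.finrank_lt_finrank_of_lt hlt
  have hs := Submodule.finrank_sup_add_finrank_inf_eq W U
  refine ⟨{z | z - y ∈ W ⊔ U}, isPlane_of_mem_iff (y := y) (W := W ⊔ U) (by omega)
    fun z => Iff.rfl, fun z hz => ?_, fun z hz => ?_⟩
  · exact (le_sup_left : W ≤ W ⊔ U) ((hWA z).1 hz)
  · exact (le_sup_right : U ≤ W ⊔ U) ((hUl z).1 hz)

variable [Fintype F] [Finite V]

lemma IsPlane.ncard_eq {k : ℕ} {A : Set V} (h : IsPlane F k A) :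
    A.ncard = Fintype.card F ^ k := by
  obtain ⟨x, W, rfl, rfl⟩ := h
  rw [← Nat.card_coe_set_eq, ← Nat.card_eq_fintype_card (α := F),
    ← Module.natCard_eq_pow_finrank (K := F) (V := W)]
  exact Nat.card_congr (Equiv.Set.image (fun v => x +ᵥ v) (W : Set V)
    (AddAction.injective x)).symm

/-- Cutting an `a`-plane by a plane not containing it drops the dimension. -/
lemma IsPlane.ncard_inter_mul_le {a b : ℕ} {A B : Set V} (hA : IsPlane F a A)
    (hB : IsPlane F b B) (h : ¬ A ⊆ B) :
    (A ∩ B).ncard * Fintype.card F ≤ Fintype.card F ^ a := by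
  rcases (A ∩ B).eq_empty_or_nonempty with h0 | ⟨y, hyA, hyB⟩
  · simp [h0]
  obtain ⟨W, hW, hWA⟩ := hA.exists_submodule hyA
  obtain ⟨U, hU, hUB⟩ := hB.exists_submodule hyB
  have hlt : W ⊓ U < W := by
    refine lt_of_le_of_ne inf_le_left fun he => h fun z hz => ?_
    exact (hUB z).2 (inf_eq_left.1 he ((hWA z).1 hz))
  have hfr := Submodule.finrank_lt_finrank_of_lt hlt
  have hpl : IsPlane F (Module.finrank F ↥(W ⊓ U)) (A ∩ B) :=
    isPlane_of_mem_iff rfl (y := y) fun z => by simp [hWA, hUB]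
  rw [hpl.ncard_eq, ← pow_succ]
  exact Nat.pow_le_pow_right Fintype.card_pos (by omega)

/-- A line not contained in a plane meets it in at most one point. -/
lemma IsPlane.eq_of_mem_inter {b : ℕ} {A B : Set V} (hA : IsPlane F 1 A)
    (hB : IsPlane F b B) (h : ¬ A ⊆ B) {x y : V} (hx : x ∈ A ∩ B) (hy : y ∈ A ∩ B) : x = y := by
  have h1 := hA.ncard_inter_mul_le hB h
  rw [pow_one] at h1
  have h2 : (A ∩ B).ncard ≤ 1 :=
    Nat.le_of_mul_le_mul_right (by simpa using h1) (Fintype.card_pos (α := F))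
  exact (Set.ncard_le_one (Set.toFinite _)).1 h2 x hx y hy

lemma IsPlane.eq_of_subset {a : ℕ} {A B : Set V} (hA : IsPlane F a A)
    (hB : IsPlane F a B) (h : A ⊆ B) : A = B :=
  Set.eq_of_subset_of_ncard_le h (by rw [hA.ncard_eq, hB.ncard_eq]) (Set.toFinite _)

/-- Two `(k+1)`-planes sharing a `k`-plane and a point outside it coincide. -/
lemma IsPlane.eq_of_common {k : ℕ} {A R S : Set V} (hA : IsPlane F k A)
    (hR : IsPlane F (k + 1) R) (hS : IsPlane F (k + 1) S) (hAR : A ⊆ R) (hAS : A ⊆ S)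
    {x : V} (hxR : x ∈ R) (hxS : x ∈ S) (hxA : x ∉ A) : R = S := by
  by_contra hne
  have h1 := hR.ncard_inter_mul_le hS fun h => hne (hR.eq_of_subset hS h)
  have h2 : A.ncard < (R ∩ S).ncard :=
    Set.ncard_lt_ncard ⟨Set.subset_inter hAR hAS, fun h => hxA (h ⟨hxR, hxS⟩)⟩ (Set.toFinite _)
  rw [hA.ncard_eq] at h2
  rw [pow_succ] at h1
  exact absurd (Nat.le_of_mul_le_mul_right h1 (Fintype.card_pos (α := F))) (by omega)

end Planes

section Counting

open Finset
open scoped Classical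

lemma half_mul_card_le_card_biUnion {ι α : Type*} (s : Finset ι) (S : ι → Finset α) {a b : ℝ}
    (ha : ∀ i ∈ s, a ≤ #(S i)) (hb : ∀ i ∈ s, ∀ j ∈ s, i ≠ j → (#(S i ∩ S j) : ℝ) ≤ b)
    (hb0 : 0 ≤ b) (hab : #s * b ≤ a / 2) : #s * (a / 2) ≤ #(s.biUnion S) := by
  induction s using Finset.induction_on with
  | empty => simp
  | insert i s hi ih =>
    rw [card_insert_of_notMem hi] at hab ⊢
    push_cast at hab ⊢
    have h1 := ih (fun j hj => ha j (mem_insert_of_mem hj))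
      (fun j hj l hl => hb j (mem_insert_of_mem hj) l (mem_insert_of_mem hl)) (by linarith)
    have h2 : (#(S i ∩ s.biUnion S) : ℝ) ≤ #s * b := by
      rw [inter_biUnion]
      calc (#(s.biUnion fun j => S i ∩ S j) : ℝ) ≤ ∑ j ∈ s, (#(S i ∩ S j) : ℝ) := by
            exact_mod_cast card_biUnion_le
        _ ≤ ∑ j ∈ s, b := sum_le_sum fun j hj => hb i (mem_insert_self _ _) j
            (mem_insert_of_mem hj) (by rintro rfl; exact hi hj)
        _ = #s * b := by simp
    have h3 : (#(S i ∪ s.biUnion S) : ℝ) + #(S i ∩ s.biUnion S) = #(S i) + #(s.biUnion S) := by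
      exact_mod_cast card_union_add_card_inter _ _
    have h4 := ha i (mem_insert_self _ _)
    rw [biUnion_insert]
    linarith

variable {F V : Type*} [Field F] [Fintype F] [AddCommGroup V] [Module F V]

variable (F) in
/-- `L` is a family of lines, each containing at least `lam * |F|` points of `P`. -/
def MeetsLines (lam : ℝ) (L : Finset (Set V)) (P : Finset V) : Prop :=
  ∀ l ∈ L, IsPlane F 1 l ∧ lam * Fintype.card F ≤ #{x ∈ P | x ∈ l}

variable (F) in
/-- Every `k`-plane contains at most `|F| ^ (2k - 3)` elements of `L`. -/
def IsPoor (k : ℕ) (L : Finset (Set V)) : Prop :=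
  ∀ R : Set V, IsPlane F k R → #{l ∈ L | l ⊆ R} * Fintype.card F ^ 3 ≤ Fintype.card F ^ (2 * k)

lemma MeetsLines.subset {lam : ℝ} {L L' : Finset (Set V)} {P : Finset V}
    (h : MeetsLines F lam L P) (hL : L' ⊆ L) : MeetsLines F lam L' P :=
  fun l hl => h l (hL hl)

lemma IsPoor.of_card_le {k : ℕ} {L : Finset (Set V)}
    (h : #L * Fintype.card F ^ 3 ≤ Fintype.card F ^ (2 * k)) : IsPoor F k L :=
  fun _ _ => le_trans (Nat.mul_le_mul_right _ (card_filter_le _ _)) h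

lemma MeetsLines.filter_subset {lam : ℝ} {L : Finset (Set V)} {P : Finset V}
    (h : MeetsLines F lam L P) (R : Set V) :
    MeetsLines F lam {l ∈ L | l ⊆ R} {x ∈ P | x ∈ R} := by
  intro l hl
  rw [mem_filter] at hl
  refine ⟨(h l hl.1).1, (h l hl.1).2.trans ?_⟩
  refine Nat.cast_le.2 (card_le_card fun x hx => ?_)
  simp only [mem_filter] at hx ⊢
  exact ⟨⟨hx.1, hl.2 hx.2⟩, hx.2⟩

/-- The lines of a hairbrush around a `k`-plane cover many points, by splitting them according to
the `(k+1)`-plane they span. -/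
lemma IsPlane.mul_card_hairbrush_le [Finite V] {k : ℕ} {A : Set V} (hA : IsPlane F k A)
    {lam c : ℝ} (hlam : 2 ≤ lam * Fintype.card F) {L : Finset (Set V)} {P : Finset V}
    (hLP : MeetsLines F lam L P) (hpoor : IsPoor F (k + 1) L)
    (hc : ∀ (L' : Finset (Set V)) (P' : Finset V), MeetsLines F (lam / 2) L' P' →
      #L' * Fintype.card F ^ 3 ≤ Fintype.card F ^ (2 * (k + 1)) →
      c * (Fintype.card F ^ 3 * #L') ≤ #P' * (Fintype.card F : ℝ) ^ (k + 1)) :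
    c * (Fintype.card F ^ 3 * #{l ∈ L | ¬ l ⊆ A ∧ (l ∩ A).Nonempty}) ≤
      #P * (Fintype.card F : ℝ) ^ (k + 1) := by
  set H : Finset (Set V) := {l ∈ L | ¬ l ⊆ A ∧ (l ∩ A).Nonempty} with hH
  have hex : ∀ l, ∃ R : Set V, l ∈ H → IsPlane F (k + 1) R ∧ A ⊆ R ∧ l ⊆ R := by
    intro l
    by_cases hl : l ∈ H
    · have hl' := mem_filter.1 hl
      obtain ⟨R, hR⟩ := hA.exists_span (hLP l hl'.1).1 hl'.2.1 hl'.2.2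
      exact ⟨R, fun _ => hR⟩
    · exact ⟨∅, fun h => absurd h hl⟩
  choose R hR using hex
  have hcard : #H = ∑ B ∈ H.image R, #{l ∈ H | R l = B} := card_eq_sum_card_image R H
  have hpts : ∑ B ∈ H.image R, #{x ∈ P | x ∈ B ∧ x ∉ A} ≤ #P := by
    rw [← card_biUnion]
    · exact card_le_card (biUnion_subset.2 fun _ _ => filter_subset _ _)
    · intro B hB C hC hBC
      refine Finset.disjoint_left.2 fun x hxB hxC => hBC ?_
      simp only [mem_coe, mem_image, mem_filter] at hB hC hxB hxC
      obtain ⟨l, hl, rfl⟩ := hB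
      obtain ⟨m, hm, rfl⟩ := hC
      exact hA.eq_of_common (hR l hl).1 (hR m hm).1 (hR l hl).2.1 (hR m hm).2.1
        hxB.2.1 hxC.2.1 hxB.2.2
  have hB : ∀ B ∈ H.image R, c * (Fintype.card F ^ 3 * #{l ∈ H | R l = B}) ≤
      #{x ∈ P | x ∈ B ∧ x ∉ A} * (Fintype.card F : ℝ) ^ (k + 1) := by
    intro B hB
    refine hc _ _ (fun l hl => ?_) ?_
    · rw [mem_filter] at hl
      obtain ⟨hlH, rfl⟩ := hl
      have hl' := mem_filter.1 hlH
      have hline := hLP l hl'.1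
      refine ⟨hline.1, ?_⟩
      have h1 : #{x ∈ P | x ∈ l ∧ x ∈ A} ≤ 1 := by
        refine card_le_one.2 fun x hx y hy => ?_
        obtain ⟨-, hx⟩ := mem_filter.1 hx
        obtain ⟨-, hy⟩ := mem_filter.1 hy
        exact hline.1.eq_of_mem_inter hA hl'.2.1 hx hy
      have h2 : #{x ∈ P | x ∈ l} ≤ #{x ∈ ({x ∈ P | x ∈ R l ∧ x ∉ A} : Finset V) | x ∈ l} +
          #{x ∈ P | x ∈ l ∧ x ∈ A} := by
        rw [← card_union_add_card_inter]
        refine le_trans (card_le_card fun x hx => ?_) (Nat.le_add_right _ _)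
        simp only [mem_filter, mem_union] at hx ⊢
        have : x ∈ l → x ∈ R l := fun hx => (hR l hlH).2.2 hx
        tauto
      have h3 : (#{x ∈ P | x ∈ l} : ℝ) ≤
          #{x ∈ ({x ∈ P | x ∈ R l ∧ x ∉ A} : Finset V) | x ∈ l} + 1 := by
        exact_mod_cast h2.trans (Nat.add_le_add_left h1 _)
      linarith [hline.2]
    · obtain ⟨m, hm, rfl⟩ := mem_image.1 hB
      refine le_trans ?_ (hpoor _ (hR m hm).1)
      refine Nat.mul_le_mul_right _ (card_le_card fun l hl => ?_)
      rw [mem_filter] at hl ⊢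
      exact ⟨(mem_filter.1 hl.1).1, hl.2 ▸ (hR l hl.1).2.2⟩
  calc c * ((Fintype.card F : ℝ) ^ 3 * #H)
      = ∑ B ∈ H.image R, c * (Fintype.card F ^ 3 * #{l ∈ H | R l = B}) := by
        rw [hcard]; push_cast; rw [mul_sum, mul_sum]
    _ ≤ ∑ B ∈ H.image R, #{x ∈ P | x ∈ B ∧ x ∉ A} * (Fintype.card F : ℝ) ^ (k + 1) :=
        sum_le_sum hB
    _ = (∑ B ∈ H.image R, #{x ∈ P | x ∈ B ∧ x ∉ A} : ℕ) * (Fintype.card F : ℝ) ^ (k + 1) := by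
        push_cast; rw [sum_mul]
    _ ≤ _ := by gcongr

variable [Fintype V]

lemma IsPlane.card_filter_mem {k : ℕ} {A : Set V} (h : IsPlane F k A) :
    #{x : V | x ∈ A} = Fintype.card F ^ k := by
  rw [← h.ncard_eq, Set.ncard_eq_toFinset_card']
  congr 1
  ext x
  simp

lemma IsPlane.card_lines_through_mul_le {k : ℕ} {R : Set V} (hR : IsPlane F k R)
    (L : Finset (Set V)) (hL : ∀ l ∈ L, IsPlane F 1 l) (p : V) :
    #{l ∈ L | p ∈ l ∧ l ⊆ R} * Fintype.card F ≤ 2 * Fintype.card F ^ k := by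
  set T : Finset (Set V) := {l ∈ L | p ∈ l ∧ l ⊆ R} with hT
  have hq : 2 ≤ Fintype.card F := Fintype.one_lt_card
  have h1 : #(T.biUnion fun l => ({x : V | x ∈ l} : Finset V).erase p)
      = ∑ l ∈ T, #(({x : V | x ∈ l} : Finset V).erase p) := by
    refine card_biUnion fun l hl m hm hlm => Finset.disjoint_left.2 fun x hxl hxm => ?_
    simp only [hT, mem_coe, mem_filter, mem_erase, mem_univ, true_and] at hl hm hxl hxm
    refine hxl.1 ((hL l hl.1).eq_of_mem_inter (hL m hm.1) (fun h => hlm ?_)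
      ⟨hxl.2, hxm.2⟩ ⟨hl.2.1, hm.2.1⟩)
    exact (hL l hl.1).eq_of_subset (hL m hm.1) h
  have h2 : ∀ l ∈ T, #(({x : V | x ∈ l} : Finset V).erase p) = Fintype.card F - 1 := by
    intro l hl
    simp only [hT, mem_filter] at hl
    rw [card_erase_of_mem (by simpa using hl.2.1), (hL l hl.1).card_filter_mem, pow_one]
  have h3 : #(T.biUnion fun l => ({x : V | x ∈ l} : Finset V).erase p) ≤ #{x : V | x ∈ R} := by
    refine card_le_card fun x hx => ?_
    simp only [mem_biUnion, hT, mem_filter, mem_erase, mem_univ, true_and] at hx ⊢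
    obtain ⟨l, hl, hx⟩ := hx
    exact hl.2.2 hx.2
  rw [h1, sum_congr rfl h2, sum_const, smul_eq_mul, hR.card_filter_mem] at h3
  calc #T * Fintype.card F ≤ #T * (2 * (Fintype.card F - 1)) := by gcongr; omega
    _ = 2 * (#T * (Fintype.card F - 1)) := by ring
    _ ≤ _ := by gcongr

lemma IsPlane.card_lines_mul_le {k : ℕ} {R : Set V} (hR : IsPlane F k R)
    (L : Finset (Set V)) (hL : ∀ l ∈ L, IsPlane F 1 l) :
    #{l ∈ L | l ⊆ R} * Fintype.card F ^ 2 ≤ 2 * Fintype.card F ^ (2 * k) := by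
  have h := sum_card_bipartiteAbove_eq_sum_card_bipartiteBelow
    (s := {l ∈ L | l ⊆ R}) (t := {x : V | x ∈ R}) (fun l x => x ∈ l)
  have h1 : ∀ l ∈ ({l ∈ L | l ⊆ R} : Finset (Set V)),
      #(bipartiteAbove (fun l x => x ∈ l) ({x : V | x ∈ R} : Finset V) l) = Fintype.card F := by
    intro l hl
    rw [mem_filter] at hl
    rw [← pow_one (Fintype.card F), ← (hL l hl.1).card_filter_mem, bipartiteAbove, filter_filter]
    congr 1
    ext x
    simpa using fun hx => hl.2 hx
  rw [sum_congr rfl h1, sum_const, smul_eq_mul] at h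
  rw [pow_two, ← mul_assoc, h, sum_mul]
  calc _ ≤ ∑ x ∈ ({x : V | x ∈ R} : Finset V), 2 * Fintype.card F ^ k := by
        refine sum_le_sum fun x _ => ?_
        refine le_trans ?_ (hR.card_lines_through_mul_le L hL x)
        gcongr
        intro l
        simp only [bipartiteBelow, mem_filter]
        tauto
    _ = _ := by
        rw [sum_const, smul_eq_mul, hR.card_filter_mem]; ring

/-- The incidence bound for families of lines that are poor in `k`-planes. -/
def PoorBound (k : ℕ) : Prop :=
  ∀ lam : ℝ, 0 < lam → ∃ c : ℝ, 0 < c ∧ c ≤ 1 ∧ ∃ q₀ : ℕ,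
    ∀ (F V : Type) [Field F] [Fintype F] [AddCommGroup V] [Module F V] [Fintype V],
      q₀ ≤ Fintype.card F → ∀ (L : Finset (Set V)) (P : Finset V),
      MeetsLines F lam L P → IsPoor F k L →
      c * (Fintype.card F ^ 3 * #L) ≤ (#P : ℝ) ^ 2 ∨
        c * (Fintype.card F ^ 3 * #L) ≤ #P * (Fintype.card F : ℝ) ^ k

/-- More than `|F| ^ (2k - 3)` lines cover at least a constant multiple of `|F| ^ k` points. -/
def RichBound (k : ℕ) : Prop :=
  ∀ lam : ℝ, 0 < lam → ∃ c : ℝ, 0 < c ∧ c ≤ 1 ∧ ∃ q₀ : ℕ,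
    ∀ (F V : Type) [Field F] [Fintype F] [AddCommGroup V] [Module F V] [Fintype V],
      q₀ ≤ Fintype.card F → ∀ (L : Finset (Set V)) (P : Finset V),
      MeetsLines F lam L P → Fintype.card F ^ (2 * k) < #L * Fintype.card F ^ 3 →
      c * (Fintype.card F : ℝ) ^ k ≤ #P

/-- A family of at most `|F| ^ (2k - 3)` lines covers at least a constant multiple of
`|F| ^ (3 - k)` points per line. -/
def SmallBound (k : ℕ) : Prop :=
  ∀ lam : ℝ, 0 < lam → ∃ c : ℝ, 0 < c ∧ c ≤ 1 ∧ ∃ q₀ : ℕ,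
    ∀ (F V : Type) [Field F] [Fintype F] [AddCommGroup V] [Module F V] [Fintype V],
      q₀ ≤ Fintype.card F → ∀ (L : Finset (Set V)) (P : Finset V),
      MeetsLines F lam L P → #L * Fintype.card F ^ 3 ≤ Fintype.card F ^ (2 * k) →
      c * (Fintype.card F ^ 3 * #L) ≤ #P * (Fintype.card F : ℝ) ^ k

lemma poorBound_one : PoorBound 1 := by
  refine fun lam _ => ⟨1, one_pos, le_rfl, 0, ?_⟩
  intro F V _ _ _ _ _ _ L P hLP hpoor
  have hL : L = ∅ := by
    refine eq_empty_of_forall_notMem fun l hl => ?_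
    have h1 := hpoor l (hLP l hl).1
    have h2 : 1 ≤ #{m ∈ L | m ⊆ l} := card_pos.2 ⟨l, by simp [hl]⟩
    have h3 : Fintype.card F ^ (2 * 1) < Fintype.card F ^ 3 :=
      Nat.pow_lt_pow_right Fintype.one_lt_card (by norm_num)
    exact absurd ((Nat.le_mul_of_pos_left _ h2).trans h1) (not_le.2 h3)
  subst hL
  left
  simp

lemma le_of_mul_sq_le {c x N : ℝ} (hc : 0 < c) (hc1 : c ≤ 1) (hN : 0 ≤ N)
    (h : c * x ^ 2 ≤ N ^ 2) : c * x ≤ N := by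
  refine le_of_sq_le_sq ?_ hN
  nlinarith [sq_nonneg x, mul_nonneg hc.le (sq_nonneg x)]

lemma RichBound.of_poorBound {k : ℕ} (hk : 1 ≤ k) (h : PoorBound k) : RichBound k := by
  intro lam hlam
  rcases Nat.lt_or_ge 1 k with hk2 | hk2
  · obtain ⟨c, hc, hc1, q₀, H⟩ := h lam hlam
    refine ⟨c, hc, hc1, q₀, fun F V _ _ _ _ _ hq L P hLP hrich => ?_⟩
    have hq0 : 0 < Fintype.card F := Fintype.card_pos
    have he : Fintype.card F ^ (2 * k) = Fintype.card F ^ (2 * k - 3) * Fintype.card F ^ 3 := by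
      rw [← pow_add]; congr 1; omega
    obtain ⟨L', hL', hcard⟩ : ∃ L' ⊆ L, #L' = Fintype.card F ^ (2 * k - 3) := by
      refine exists_subset_card_eq (le_of_lt ?_)
      rw [he] at hrich
      exact lt_of_mul_lt_mul_right hrich (Nat.zero_le _)
    have hcR : (Fintype.card F : ℝ) ^ 3 * #L' = (Fintype.card F : ℝ) ^ k * Fintype.card F ^ k := by
      rw [hcard, ← pow_add, ← two_mul]
      exact_mod_cast (mul_comm _ _).trans he.symm
    have hqR : (0 : ℝ) < (Fintype.card F : ℝ) ^ k := by positivity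
    rcases H F V hq L' P (hLP.subset hL') (.of_card_le (by rw [hcard, he])) with h1 | h1
    · rw [hcR, ← pow_two] at h1
      exact le_of_mul_sq_le hc hc1 (Nat.cast_nonneg _) h1
    · rw [hcR, ← mul_assoc] at h1
      exact le_of_mul_le_mul_right h1 hqR
  · obtain rfl : k = 1 := by omega
    refine ⟨min lam 1, by positivity, min_le_right _ _, 0,
      fun F V _ _ _ _ _ hq L P hLP hrich => ?_⟩
    obtain ⟨l, hl⟩ : L.Nonempty := by
      rw [nonempty_iff_ne_empty]
      rintro rfl
      simp at hrich
    have h1 : (#{x ∈ P | x ∈ l} : ℝ) ≤ #P := by exact_mod_cast card_filter_le _ _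
    calc min lam 1 * (Fintype.card F : ℝ) ^ 1 ≤ lam * Fintype.card F := by
          rw [pow_one]; gcongr; exact min_le_left _ _
      _ ≤ _ := (hLP l hl).2.trans h1

variable (F) in
/-- The `k`-planes containing more than `|F| ^ (2k - 3)` elements of `L`. -/
noncomputable def richPlanes (k : ℕ) (L : Finset (Set V)) : Finset (Set V) :=
  {R | IsPlane F k R ∧ Fintype.card F ^ (2 * k) < #{l ∈ L | l ⊆ R} * Fintype.card F ^ 3}

lemma mem_richPlanes {k : ℕ} {L : Finset (Set V)} {R : Set V} :
    R ∈ richPlanes F k L ↔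
      IsPlane F k R ∧ Fintype.card F ^ (2 * k) < #{l ∈ L | l ⊆ R} * Fintype.card F ^ 3 := by
  simp [richPlanes]

lemma isPoor_filter_richPlanes (k : ℕ) (L : Finset (Set V)) :
    IsPoor F k {l ∈ L | ∀ R ∈ richPlanes F k L, ¬ l ⊆ R} := by
  intro R hR
  by_cases hrich : R ∈ richPlanes F k L
  · have : #{l ∈ {l ∈ L | ∀ R ∈ richPlanes F k L, ¬ l ⊆ R} | l ⊆ R} = 0 := by
      rw [card_eq_zero, filter_eq_empty_iff]
      exact fun l hl => (mem_filter.1 hl).2 R hrich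
    simp [this]
  · rw [mem_richPlanes, not_and, not_lt] at hrich
    refine le_trans ?_ (hrich hR)
    gcongr
    exact filter_subset _ _

/-- Lines lying in rich `k`-planes are covered by few planes, hence force many planes. -/
lemma card_filter_richPlanes_mul_le (k : ℕ) (L : Finset (Set V)) (hL : ∀ l ∈ L, IsPlane F 1 l) :
    #{l ∈ L | ¬ ∀ R ∈ richPlanes F k L, ¬ l ⊆ R} * Fintype.card F ^ 2 ≤
      #(richPlanes F k L) * (2 * Fintype.card F ^ (2 * k)) := by
  have h1 : ({l ∈ L | ¬ ∀ R ∈ richPlanes F k L, ¬ l ⊆ R} : Finset (Set V)) ⊆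
      (richPlanes F k L).biUnion fun R => {l ∈ L | l ⊆ R} := by
    intro l hl
    simp only [mem_filter, not_forall, not_not, mem_biUnion] at hl ⊢
    obtain ⟨hl, R, hR, hlR⟩ := hl
    exact ⟨R, hR, hl, hlR⟩
  calc _ ≤ (∑ R ∈ richPlanes F k L, #{l ∈ L | l ⊆ R}) * Fintype.card F ^ 2 := by
        gcongr
        exact (card_le_card h1).trans card_biUnion_le
    _ = ∑ R ∈ richPlanes F k L, #{l ∈ L | l ⊆ R} * Fintype.card F ^ 2 := sum_mul _ _ _
    _ ≤ ∑ R ∈ richPlanes F k L, 2 * Fintype.card F ^ (2 * k) :=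
        sum_le_sum fun R hR => (mem_richPlanes.1 hR).1.card_lines_mul_le L hL
    _ = _ := by simp

lemma card_le_two_mul_of_filter {α : Type*} (s : Finset α) (p : α → Prop) [DecidablePred p]
    [DecidablePred fun x => ¬ p x] :
    #s ≤ 2 * #{x ∈ s | p x} ∨ #s ≤ 2 * #{x ∈ s | ¬ p x} := by
  have : #{x ∈ s | p x} + #{x ∈ s | ¬ p x} = #s := card_filter_add_card_filter_not p
  omega

/-- Many rich `k`-planes cover many points, since two of them share few points. -/
lemma mul_le_card_of_richPlanes {k t : ℕ} {c : ℝ} (hc : 0 < c) (L : Finset (Set V))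
    (P : Finset V) (ht : t ≤ #(richPlanes F k L)) (htq : (t : ℝ) ≤ c * Fintype.card F / 2)
    (hP : ∀ R ∈ richPlanes F k L, c * (Fintype.card F : ℝ) ^ k ≤ #{x ∈ P | x ∈ R}) :
    t * (c * (Fintype.card F : ℝ) ^ k / 2) ≤ #P := by
  have hQ : (0 : ℝ) < Fintype.card F := by exact_mod_cast Fintype.card_pos
  obtain ⟨T, hT, rfl⟩ := exists_subset_card_eq ht
  refine (half_mul_card_le_card_biUnion T (fun R => {x ∈ P | x ∈ R})
    (b := (Fintype.card F : ℝ) ^ k / Fintype.card F) (fun R hR => hP R (hT hR)) ?_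
    (by positivity) ?_).trans ?_
  · intro R hR S hS hne
    have hR' := (mem_richPlanes.1 (hT hR)).1
    have hS' := (mem_richPlanes.1 (hT hS)).1
    have h1 := hR'.ncard_inter_mul_le hS' fun h => hne (hR'.eq_of_subset hS' h)
    rw [le_div_iff₀ hQ]
    have h2 : #({x ∈ P | x ∈ R} ∩ {x ∈ P | x ∈ S}) ≤ (R ∩ S).ncard := by
      rw [← Set.ncard_coe_finset]
      refine Set.ncard_le_ncard (fun x hx => ?_) (Set.toFinite _)
      simp only [mem_coe, mem_inter, mem_filter] at hx
      exact ⟨hx.1.2, hx.2.2⟩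
    exact_mod_cast (Nat.mul_le_mul_right _ h2).trans h1
  · calc (#T : ℝ) * ((Fintype.card F : ℝ) ^ k / Fintype.card F)
        ≤ (c * Fintype.card F / 2) * ((Fintype.card F : ℝ) ^ k / Fintype.card F) := by gcongr
      _ = _ := by field_simp
  · exact Nat.cast_le.2 (card_le_card (biUnion_subset.2 fun R _ => filter_subset _ _))

lemma SmallBound.of_poorBound {k : ℕ} (hk : 1 ≤ k) (h : PoorBound k) : SmallBound (k + 1) := by
  intro lam hlam
  obtain ⟨c₀, hc₀, hc₀1, q₀, H₀⟩ := h lam hlam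
  obtain ⟨c₁, hc₁, hc₁1, q₁, H₁⟩ := RichBound.of_poorBound hk h lam hlam
  refine ⟨min (c₀ / 2) (c₁ ^ 2 / 8), by positivity, (min_le_left _ _).trans (by linarith),
    max (max q₀ q₁) ⌈4 / c₁⌉₊, ?_⟩
  intro F V _ _ _ _ _ hq L P hLP hsmall
  simp only [max_le_iff] at hq
  obtain ⟨⟨hq₀, hq₁⟩, hq₂⟩ := hq
  have hq₂' : 4 ≤ c₁ * Fintype.card F := by
    have := (Nat.ceil_le.1 hq₂)
    rwa [div_le_iff₀' hc₁] at this
  have hQ : (0 : ℝ) < Fintype.card F := by exact_mod_cast Fintype.card_pos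
  have hsmall' : (#L : ℝ) * (Fintype.card F : ℝ) ^ 3 ≤ (Fintype.card F : ℝ) ^ (2 * (k + 1)) := by
    exact_mod_cast hsmall
  rcases card_le_two_mul_of_filter L (fun l => ∀ R ∈ richPlanes F k L, ¬ l ⊆ R) with h2 | h2
  · have hpoor := isPoor_filter_richPlanes (F := F) k L
    have hsub : ({l ∈ L | ∀ R ∈ richPlanes F k L, ¬ l ⊆ R} : Finset (Set V)) ⊆ L :=
      filter_subset _ _
    set L₂ : Finset (Set V) := {l ∈ L | ∀ R ∈ richPlanes F k L, ¬ l ⊆ R}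
    have h2' : (#L : ℝ) ≤ 2 * #L₂ := by exact_mod_cast h2
    have h3' : (#L₂ : ℝ) ≤ #L := by exact_mod_cast card_le_card hsub
    have key : c₀ * (Fintype.card F ^ 3 * #L₂) ≤ #P * (Fintype.card F : ℝ) ^ (k + 1) := by
      rcases H₀ F V hq₀ L₂ P (hLP.subset hsub) hpoor with h4 | h4
      · refine le_of_mul_sq_le hc₀ hc₀1 (by positivity) ?_
        calc c₀ * ((Fintype.card F : ℝ) ^ 3 * #L₂) ^ 2
            = (c₀ * ((Fintype.card F : ℝ) ^ 3 * #L₂)) * (#L₂ * (Fintype.card F : ℝ) ^ 3) := by ring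
          _ ≤ (#P : ℝ) ^ 2 * (#L * (Fintype.card F : ℝ) ^ 3) := by gcongr
          _ ≤ (#P : ℝ) ^ 2 * (Fintype.card F : ℝ) ^ (2 * (k + 1)) := by gcongr
          _ = _ := by ring
      · refine h4.trans ?_
        gcongr
        · exact_mod_cast Fintype.card_pos
        · omega
    calc min (c₀ / 2) (c₁ ^ 2 / 8) * ((Fintype.card F : ℝ) ^ 3 * #L)
        ≤ (c₀ / 2) * ((Fintype.card F : ℝ) ^ 3 * (2 * #L₂)) := by
          gcongr; exact min_le_left _ _
      _ = c₀ * (Fintype.card F ^ 3 * #L₂) := by ring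
      _ ≤ _ := key
  · have h3 := card_filter_richPlanes_mul_le (F := F) k L fun l hl => (hLP l hl).1
    have hrich : ∀ R ∈ richPlanes F k L, c₁ * (Fintype.card F : ℝ) ^ k ≤ #{x ∈ P | x ∈ R} :=
      fun R hR => H₁ F V hq₁ _ _ (hLP.filter_subset R) (mem_richPlanes.1 hR).2
    set L₃ : Finset (Set V) := {l ∈ L | ¬ ∀ R ∈ richPlanes F k L, ¬ l ⊆ R}
    have h2' : (#L : ℝ) ≤ 2 * #L₃ := by exact_mod_cast h2
    have h3' : (#L₃ : ℝ) * (Fintype.card F : ℝ) ^ 2 ≤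
        #(richPlanes F k L) * (2 * (Fintype.card F : ℝ) ^ (2 * k)) := by exact_mod_cast h3
    rcases le_total (#(richPlanes F k L)) ⌊c₁ * Fintype.card F / 2⌋₊ with h4 | h4
    · have h5 := mul_le_card_of_richPlanes hc₁ L P le_rfl
        ((Nat.cast_le.2 h4).trans (Nat.floor_le (by positivity))) hrich
      calc min (c₀ / 2) (c₁ ^ 2 / 8) * ((Fintype.card F : ℝ) ^ 3 * #L)
          ≤ (c₁ / 8) * ((Fintype.card F : ℝ) ^ 3 * (2 * #L₃)) := by
            gcongr; exact (min_le_right _ _).trans (by nlinarith)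
        _ = (c₁ / 4) * Fintype.card F * (#L₃ * (Fintype.card F : ℝ) ^ 2) := by ring
        _ ≤ (c₁ / 4) * Fintype.card F *
            (#(richPlanes F k L) * (2 * (Fintype.card F : ℝ) ^ (2 * k))) := by gcongr
        _ = (#(richPlanes F k L) * (c₁ * (Fintype.card F : ℝ) ^ k / 2)) *
            (Fintype.card F : ℝ) ^ (k + 1) := by ring
        _ ≤ _ := by gcongr
    · have h5 := mul_le_card_of_richPlanes hc₁ L P h4 (Nat.floor_le (by positivity)) hrich
      have h6 : c₁ * Fintype.card F / 4 ≤ (⌊c₁ * Fintype.card F / 2⌋₊ : ℝ) := by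
        have := Nat.lt_floor_add_one (c₁ * Fintype.card F / 2)
        linarith
      calc min (c₀ / 2) (c₁ ^ 2 / 8) * ((Fintype.card F : ℝ) ^ 3 * #L)
          ≤ (c₁ ^ 2 / 8) * (#L * (Fintype.card F : ℝ) ^ 3) := by
            rw [mul_comm (#L : ℝ)]; gcongr; exact min_le_right _ _
        _ ≤ (c₁ ^ 2 / 8) * (Fintype.card F : ℝ) ^ (2 * (k + 1)) := by gcongr
        _ = (c₁ * Fintype.card F / 4 * (c₁ * (Fintype.card F : ℝ) ^ k / 2)) *
            (Fintype.card F : ℝ) ^ (k + 1) := by ring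
        _ ≤ (⌊c₁ * Fintype.card F / 2⌋₊ * (c₁ * (Fintype.card F : ℝ) ^ k / 2)) *
            (Fintype.card F : ℝ) ^ (k + 1) := by gcongr
        _ ≤ _ := by gcongr

/-- After discarding the points of low degree, a positive proportion of the lines stay rich. -/
lemma MeetsLines.mul_card_le_of_popular {lam D : ℝ} {L : Finset (Set V)} {P : Finset V}
    (h : MeetsLines F lam L P) (hlam : 0 ≤ lam) (hD0 : 0 ≤ D)
    (hD : 2 * (#P * D) ≤ lam * Fintype.card F * #L) :
    lam * #L ≤ 4 * #{l ∈ L | lam / 4 * Fintype.card F ≤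
      #{x ∈ ({x ∈ P | D ≤ (#{l ∈ L | x ∈ l} : ℝ)} : Finset V) | x ∈ l}} := by
  have hQ : (0 : ℝ) < Fintype.card F := by exact_mod_cast Fintype.card_pos
  set Ph : Finset V := {x ∈ P | D ≤ (#{l ∈ L | x ∈ l} : ℝ)} with hPh
  set L₁ : Finset (Set V) := {l ∈ L | lam / 4 * Fintype.card F ≤ #{x ∈ Ph | x ∈ l}} with hL₁
  have hlow : ∑ l ∈ L, (#{x ∈ P \ Ph | x ∈ l} : ℝ) ≤ #P * D := by
    have h1 := sum_card_bipartiteAbove_eq_sum_card_bipartiteBelow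
      (s := L) (t := P \ Ph) (fun l x => x ∈ l)
    simp only [bipartiteAbove, bipartiteBelow] at h1
    have h2 : ∀ x ∈ P \ Ph, (#{l ∈ L | x ∈ l} : ℝ) ≤ D := by
      intro x hx
      simp only [hPh, mem_sdiff, mem_filter, not_and, not_le] at hx
      exact (hx.2 hx.1).le
    calc ∑ l ∈ L, (#{x ∈ P \ Ph | x ∈ l} : ℝ) = ∑ x ∈ P \ Ph, (#{l ∈ L | x ∈ l} : ℝ) := by
          exact_mod_cast h1
      _ ≤ ∑ x ∈ P \ Ph, D := sum_le_sum h2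
      _ = #(P \ Ph) * D := by simp
      _ ≤ #P * D := by gcongr; exact sdiff_subset
  have hline : ∀ l ∈ L, lam * Fintype.card F ≤ lam / 4 * Fintype.card F +
      (if lam / 4 * Fintype.card F ≤ #{x ∈ Ph | x ∈ l} then (Fintype.card F : ℝ) else 0) +
        #{x ∈ P \ Ph | x ∈ l} := by
    intro l hl
    have h1 := (h l hl).2
    have h2 : (#{x ∈ P | x ∈ l} : ℝ) ≤ #{x ∈ Ph | x ∈ l} + #{x ∈ P \ Ph | x ∈ l} := by
      norm_cast
      rw [← card_union_add_card_inter]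
      refine le_trans (card_le_card fun x hx => ?_) (Nat.le_add_right _ _)
      simp only [mem_filter, mem_union, mem_sdiff] at hx ⊢
      tauto
    have h3 : (#{x ∈ Ph | x ∈ l} : ℝ) ≤ Fintype.card F := by
      have : #{x ∈ Ph | x ∈ l} ≤ #{x : V | x ∈ l} := card_le_card fun x hx => by
        simpa using (mem_filter.1 hx).2
      rw [(h l hl).1.card_filter_mem, pow_one] at this
      exact_mod_cast this
    have h4 : 0 ≤ lam / 4 * Fintype.card F := by positivity
    split_ifs with h5 <;> linarith
  have hsum := sum_le_sum hline
  rw [sum_add_distrib, sum_add_distrib, ← sum_filter] at hsum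
  simp only [sum_const, nsmul_eq_mul] at hsum
  have h6 : lam * #L * Fintype.card F ≤ 4 * #L₁ * Fintype.card F := by linarith
  exact le_of_mul_le_mul_right h6 hQ

/-- The number of lines meeting a plane transversally in popular points. -/
lemma IsPlane.card_mul_le_hairbrush {k : ℕ} {A : Set V} (hA : IsPlane F k A) {D : ℝ}
    (hD : 4 * (Fintype.card F : ℝ) ^ k ≤ D * Fintype.card F) {L : Finset (Set V)}
    (hL : ∀ l ∈ L, IsPlane F 1 l) {S : Finset V}
    (hS : ∀ x ∈ S, x ∈ A ∧ D ≤ #{l ∈ L | x ∈ l}) :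
    #S * (D / 2) ≤ #{l ∈ L | ¬ l ⊆ A ∧ (l ∩ A).Nonempty} := by
  have hQ : (0 : ℝ) < Fintype.card F := by exact_mod_cast Fintype.card_pos
  have h1 : #(S.biUnion fun x => {l ∈ L | x ∈ l ∧ ¬ l ⊆ A}) =
      ∑ x ∈ S, #{l ∈ L | x ∈ l ∧ ¬ l ⊆ A} := by
    refine card_biUnion fun x hx y hy hxy => Finset.disjoint_left.2 fun l hlx hly => hxy ?_
    simp only [mem_filter] at hlx hly
    exact (hL l hlx.1).eq_of_mem_inter hA hlx.2.2 ⟨hlx.2.1, (hS x hx).1⟩ ⟨hly.2.1, (hS y hy).1⟩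
  have h2 : (S.biUnion fun x => {l ∈ L | x ∈ l ∧ ¬ l ⊆ A}) ⊆
      ({l ∈ L | ¬ l ⊆ A ∧ (l ∩ A).Nonempty} : Finset (Set V)) := by
    intro l hl
    simp only [mem_biUnion, mem_filter] at hl ⊢
    obtain ⟨x, hx, hl, hxl, hlA⟩ := hl
    exact ⟨hl, hlA, x, hxl, (hS x hx).1⟩
  have h3 : ∀ x ∈ S, D / 2 ≤ (#{l ∈ L | x ∈ l ∧ ¬ l ⊆ A} : ℝ) := by
    intro x hx
    have h4 : (#{l ∈ L | x ∈ l ∧ l ⊆ A} : ℝ) * Fintype.card F ≤ 2 * (Fintype.card F : ℝ) ^ k := by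
      exact_mod_cast hA.card_lines_through_mul_le L hL x
    have h5 : (#{l ∈ L | x ∈ l ∧ l ⊆ A} : ℝ) ≤ D / 2 :=
      le_of_mul_le_mul_right (by linarith) hQ
    have h6 : (#{l ∈ L | x ∈ l} : ℝ) ≤
        #{l ∈ L | x ∈ l ∧ l ⊆ A} + #{l ∈ L | x ∈ l ∧ ¬ l ⊆ A} := by
      norm_cast
      rw [← card_union_add_card_inter]
      refine le_trans (card_le_card fun l hl => ?_) (Nat.le_add_right _ _)
      simp only [mem_filter, mem_union] at hl ⊢
      tauto
    linarith [(hS x hx).2]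
  calc #S * (D / 2) = ∑ x ∈ S, D / 2 := by simp
    _ ≤ ∑ x ∈ S, (#{l ∈ L | x ∈ l ∧ ¬ l ⊆ A} : ℝ) := sum_le_sum h3
    _ = #(S.biUnion fun x => {l ∈ L | x ∈ l ∧ ¬ l ⊆ A}) := by rw [h1]; push_cast; rfl
    _ ≤ _ := Nat.cast_le.2 (card_le_card h2)

lemma PoorBound.succ {k : ℕ} (hk : 1 ≤ k) (h : PoorBound k) : PoorBound (k + 1) := by
  intro lam hlam
  obtain ⟨c₀, hc₀, hc₀1, q₀, H₀⟩ := h lam hlam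
  obtain ⟨c₁, hc₁, hc₁1, q₁, H₁⟩ := RichBound.of_poorBound hk h (lam / 4) (by positivity)
  obtain ⟨c₂, hc₂, hc₂1, q₂, H₂⟩ := SmallBound.of_poorBound hk h (lam / 2) (by positivity)
  obtain ⟨c, hc, hc1, hca, hcb, hcc⟩ : ∃ c : ℝ, 0 < c ∧ c ≤ 1 ∧ c ≤ c₀ * (lam / 4) ∧
      c ≤ lam / 8 ∧ c ≤ c₂ * c₁ * lam / 4 :=
    ⟨min 1 (min (c₀ * (lam / 4)) (min (lam / 8) (c₂ * c₁ * lam / 4))), by positivity,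
      by simp, by simp, by simp, by simp⟩
  refine ⟨c, hc, hc1, max (max q₀ q₁) (max q₂ ⌈2 / lam⌉₊), ?_⟩
  intro F V _ _ _ _ _ hq L P hLP hpoor
  simp only [max_le_iff] at hq
  obtain ⟨⟨hq₀, hq₁⟩, hq₂, hq₃⟩ := hq
  have hq₃' : 2 ≤ lam * Fintype.card F := by
    have := Nat.ceil_le.1 hq₃
    rwa [div_le_iff₀' hlam] at this
  have hQ1 : (1 : ℝ) ≤ Fintype.card F := by exact_mod_cast Fintype.card_pos
  have hQ : (0 : ℝ) < Fintype.card F := by linarith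
  rcases P.eq_empty_or_nonempty with rfl | hP
  · have hL : L = ∅ := by
      refine eq_empty_of_forall_notMem fun l hl => ?_
      have := (hLP l hl).2
      simp only [filter_empty, card_empty, Nat.cast_zero] at this
      linarith
    simp [hL]
  have hN : (0 : ℝ) < #P := by exact_mod_cast hP.card_pos
  obtain ⟨D, hD⟩ : ∃ D : ℝ, D = lam * Fintype.card F * #L / (2 * #P) := ⟨_, rfl⟩
  have hD0 : 0 ≤ D := by rw [hD]; positivity
  have hDN : 2 * (#P * D) = lam * Fintype.card F * #L := by rw [hD]; field_simp
  have hpop := hLP.mul_card_le_of_popular hlam.le hD0 hDN.le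
  set Ph : Finset V := {x ∈ P | D ≤ (#{l ∈ L | x ∈ l} : ℝ)} with hPh
  set L₁ : Finset (Set V) := {l ∈ L | lam / 4 * Fintype.card F ≤ #{x ∈ Ph | x ∈ l}} with hL₁
  have hL₁L : L₁ ⊆ L := filter_subset _ _
  have hL₁P : MeetsLines F (lam / 4) L₁ Ph := fun l hl =>
    ⟨(hLP l (hL₁L hl)).1, (mem_filter.1 hl).2⟩
  by_cases hpoor₁ : IsPoor F k L₁
  · have hle : c * ((Fintype.card F : ℝ) ^ 3 * #L) ≤ c₀ * (Fintype.card F ^ 3 * #L₁) := by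
      calc c * ((Fintype.card F : ℝ) ^ 3 * #L)
          ≤ (c₀ * (lam / 4)) * ((Fintype.card F : ℝ) ^ 3 * #L) := by gcongr
        _ = c₀ / 4 * (Fintype.card F : ℝ) ^ 3 * (lam * #L) := by ring
        _ ≤ c₀ / 4 * (Fintype.card F : ℝ) ^ 3 * (4 * #L₁) := by gcongr
        _ = _ := by ring
    refine (H₀ F V hq₀ L₁ P (hLP.subset hL₁L) hpoor₁).imp hle.trans fun h1 => hle.trans ?_
    refine h1.trans ?_
    gcongr
    omega
  · simp only [IsPoor, not_forall, not_le] at hpoor₁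
    obtain ⟨A, hA, hrich⟩ := hpoor₁
    have hS := H₁ F V hq₁ _ _ (hL₁P.filter_subset A) hrich
    set S : Finset V := {x ∈ Ph | x ∈ A} with hS_def
    by_cases hDk : 4 * (Fintype.card F : ℝ) ^ k ≤ D * Fintype.card F
    · left
      have hh := hA.card_mul_le_hairbrush hDk (fun l hl => (hLP l hl).1) (S := S) (by
        intro x hx
        rw [hS_def, mem_filter, hPh, mem_filter] at hx
        exact ⟨hx.2, hx.1.2⟩)
      have hp := hA.mul_card_hairbrush_le hq₃' hLP hpoor (H₂ F V hq₂)
      set H : Finset (Set V) := {l ∈ L | ¬ l ⊆ A ∧ (l ∩ A).Nonempty}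
      have hQk : (0 : ℝ) < (Fintype.card F : ℝ) ^ (k + 1) := by positivity
      refine le_of_mul_le_mul_right ?_ hQk
      calc c * ((Fintype.card F : ℝ) ^ 3 * #L) * (Fintype.card F : ℝ) ^ (k + 1)
          ≤ (c₂ * c₁ * lam / 4) * ((Fintype.card F : ℝ) ^ 3 * #L) *
            (Fintype.card F : ℝ) ^ (k + 1) := by gcongr
        _ = c₂ / 4 * (Fintype.card F : ℝ) ^ 3 * (c₁ * (Fintype.card F : ℝ) ^ k) *
            (lam * Fintype.card F * #L) := by ring
        _ = c₂ * (Fintype.card F : ℝ) ^ 3 * #P *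
            ((c₁ * (Fintype.card F : ℝ) ^ k) * (D / 2)) := by rw [← hDN]; ring
        _ ≤ c₂ * (Fintype.card F : ℝ) ^ 3 * #P * (#S * (D / 2)) := by gcongr
        _ ≤ c₂ * (Fintype.card F : ℝ) ^ 3 * #P * #H := by gcongr
        _ = #P * (c₂ * ((Fintype.card F : ℝ) ^ 3 * #H)) := by ring
        _ ≤ #P * (#P * (Fintype.card F : ℝ) ^ (k + 1)) := by gcongr
        _ = _ := by ring
    · right
      rw [not_le] at hDk
      calc c * ((Fintype.card F : ℝ) ^ 3 * #L)
          ≤ (lam / 8) * ((Fintype.card F : ℝ) ^ 3 * #L) := by gcongr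
        _ = (Fintype.card F : ℝ) ^ 2 / 8 * (lam * Fintype.card F * #L) := by ring
        _ = #P * Fintype.card F / 4 * (D * Fintype.card F) := by rw [← hDN]; ring
        _ ≤ #P * Fintype.card F / 4 * (4 * (Fintype.card F : ℝ) ^ k) := by gcongr
        _ = _ := by ring

theorem poorBound {k : ℕ} (hk : 1 ≤ k) : PoorBound k := by
  induction k, hk using Nat.le_induction with
  | base => exact poorBound_one
  | succ k hk ih => exact ih.succ hk

lemma rpow_bound_of_sq {q N d β c : ℝ} (hq : 0 < q) (hN : 0 ≤ N) (hc : 0 ≤ c)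
    (h : c * (q ^ 3 * q ^ (2 * (d - 1) + β)) ≤ N ^ 2) :
    √c * q ^ (d + (β + 1) / 2) ≤ N := by
  refine le_of_sq_le_sq (le_of_eq_of_le ?_ h) hN
  rw [mul_pow, Real.sq_sqrt hc, ← Real.rpow_natCast q 3, ← Real.rpow_add hq,
    ← Real.rpow_mul_natCast hq.le]
  congr 2
  push_cast
  ring

lemma rpow_bound_of_mul {q N β c : ℝ} {d : ℕ} (hq : 1 ≤ q) (hc : 0 ≤ c) (hβ : -1 ≤ β)
    (h : c * (q ^ 3 * q ^ (2 * ((d : ℝ) - 1) + β)) ≤ N * q ^ d) :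
    c * q ^ ((d : ℝ) + (β + 1) / 2) ≤ N := by
  have hq0 : 0 < q := by linarith
  refine le_of_mul_le_mul_right (le_trans ?_ h) (pow_pos hq0 d)
  rw [mul_assoc, ← Real.rpow_natCast q 3, ← Real.rpow_natCast q d, ← Real.rpow_add hq0,
    ← Real.rpow_add hq0]
  refine mul_le_mul_of_nonneg_left (Real.rpow_le_rpow_of_exponent_le hq ?_) hc
  push_cast
  linarith

end Counting

/-- **Proposition 3.1, estimate (3.2): the case of the `d`-plane Wolff axiom.** -/
theorem lines_points_incidence_bound_wolff (d : ℕ) (hd : 2 ≤ d)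
    (γ lam : ℝ) (hγ0 : 0 < γ) (hγ1 : γ ≤ 1) (hlam0 : 0 < lam) (hlam1 : lam ≤ 1) :
    ∃ c : ℝ, 0 < c ∧
      ∀ (F : Type) [Field F] [Fintype F] (n : ℕ) (β : ℝ),
        max (1 - (d : ℝ)) (-1) ≤ β → β ≤ 1 →
        ∀ (L : Set (Set (Fin n → F))) (P : Set (Fin n → F)),
          (∀ ℓ ∈ L, IsPlane F 1 ℓ) →
          DPlaneWolffAxiom F d L →
          (L.ncard : ℝ) ≥ γ * (Fintype.card F : ℝ) ^ (2 * ((d : ℝ) - 1) + β) →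
          (∀ ℓ ∈ L, ({x ∈ P | x ∈ ℓ}.ncard : ℝ) ≥ lam * (Fintype.card F : ℝ)) →
          (P.ncard : ℝ) ≥ c * (Fintype.card F : ℝ) ^ ((d : ℝ) + (β + 1) / 2) := by
  classical
  have hd1 : 1 ≤ d := by omega
  obtain ⟨c₀, hc₀, -, q₀, H⟩ := poorBound hd1 lam hlam0
  obtain ⟨c, hc, hca, hcb, hcc⟩ : ∃ c : ℝ, 0 < c ∧ c ≤ √(c₀ * γ) ∧ c ≤ c₀ * γ ∧
      c ≤ (((q₀ : ℝ) + 1) ^ (d + 1))⁻¹ :=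
    ⟨min √(c₀ * γ) (min (c₀ * γ) (((q₀ : ℝ) + 1) ^ (d + 1))⁻¹), by positivity,
      by simp, by simp, by simp⟩
  refine ⟨c, hc, fun F _ _ n β hβ hβ1 L P hL hW hcard hP => ?_⟩
  have hβ0 : -1 ≤ β := (le_max_right _ _).trans hβ
  have hQ1 : (1 : ℝ) ≤ Fintype.card F := by exact_mod_cast Fintype.card_pos
  have hQ : (0 : ℝ) < Fintype.card F := by linarith
  have hLfin := Set.ncard_eq_toFinset_card' L
  have hPfin := Set.ncard_eq_toFinset_card' P
  have hmeet : MeetsLines F lam L.toFinset P.toFinset := by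
    intro l hl
    rw [Set.mem_toFinset] at hl
    refine ⟨hL l hl, (hP l hl).trans_eq ?_⟩
    rw [Set.ncard_eq_toFinset_card']
    congr 2
    ext x
    rw [Set.mem_toFinset, Finset.mem_filter, Set.mem_toFinset]
    rfl
  rcases le_or_gt q₀ (Fintype.card F) with hq | hq
  · have hpoor : IsPoor F d L.toFinset := by
      intro R hR
      have h1 := hW R hR
      rw [Set.ncard_eq_toFinset_card'] at h1
      have h2 : ({l ∈ L.toFinset | l ⊆ R} : Finset (Set (Fin n → F))) =
          {l ∈ L | l ⊆ R}.toFinset := by ext; simp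
      rw [h2]
      calc _ ≤ Fintype.card F ^ (2 * d - 3) * Fintype.card F ^ 3 := by gcongr
        _ = _ := by rw [← pow_add]; congr 1; omega
    have key := H F (Fin n → F) hq _ _ hmeet hpoor
    rw [← hLfin, ← hPfin] at key
    have hle : c₀ * γ * ((Fintype.card F : ℝ) ^ 3 *
        (Fintype.card F : ℝ) ^ (2 * ((d : ℝ) - 1) + β)) ≤
        c₀ * (Fintype.card F ^ 3 * L.ncard) := by
      calc _ = c₀ * ((Fintype.card F : ℝ) ^ 3 *
            (γ * (Fintype.card F : ℝ) ^ (2 * ((d : ℝ) - 1) + β))) := by ring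
        _ ≤ _ := by gcongr
    rcases key with h1 | h1
    · refine le_trans ?_ (rpow_bound_of_sq hQ (Nat.cast_nonneg _) (by positivity) (hle.trans h1))
      gcongr
    · refine le_trans ?_ (rpow_bound_of_mul hQ1 (by positivity) hβ0 (hle.trans h1))
      gcongr
  · have hLne : L.Nonempty := by
      rw [Set.nonempty_iff_ne_empty]
      rintro rfl
      have : 0 < γ * (Fintype.card F : ℝ) ^ (2 * ((d : ℝ) - 1) + β) := by positivity
      simp only [Set.ncard_empty, Nat.cast_zero] at hcard
      linarith
    obtain ⟨l, hl⟩ := hLne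
    have hPpos : 0 < P.ncard := by
      have h1 : (0 : ℝ) < {x ∈ P | x ∈ l}.ncard :=
        lt_of_lt_of_le (mul_pos hlam0 hQ) (hP l hl)
      exact (Nat.cast_pos.1 h1).trans_le
        (Set.ncard_le_ncard (Set.sep_subset _ _) (Set.toFinite _))
    have hq' : (Fintype.card F : ℝ) ≤ (q₀ : ℝ) + 1 := by
      have : (Fintype.card F : ℝ) ≤ q₀ := by exact_mod_cast hq.le
      linarith
    calc c * (Fintype.card F : ℝ) ^ ((d : ℝ) + (β + 1) / 2)
        ≤ (((q₀ : ℝ) + 1) ^ (d + 1))⁻¹ * (Fintype.card F : ℝ) ^ (((d + 1 : ℕ) : ℝ)) := by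
          refine mul_le_mul hcc (Real.rpow_le_rpow_of_exponent_le hQ1 ?_) (by positivity)
            (by positivity)
          push_cast
          linarith
      _ ≤ (((q₀ : ℝ) + 1) ^ (d + 1))⁻¹ * ((q₀ : ℝ) + 1) ^ (d + 1) := by
          rw [Real.rpow_natCast]; gcongr
      _ = 1 := inv_mul_cancel₀ (by positivity)
      _ ≤ P.ncard := by exact_mod_cast hPpos
end

section
/- Let d ≥ k ≥ 1 be integers and let 0 < γ ≤ 1, 0 < λ ≤ 1 be real numbers. There exists a constant c > 0 depending only on d, k, γ, λ such that: for every finite field F, every n, every real β with 0 ≤ β ≤ k, every collection L of k-planes in F^n with |L| ≥ γ · |F|^{(k+1)(d-k)+β}, and every collection P of (k-1)-planes in F^n satisfying |{P' ∈ P : P' ⊆ L'}| ≥ λ · |F|^k for every L' ∈ L, one has |P| ≥ c · |F|^{k(d-k+1)+β}. -/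
open scoped Pointwise

namespace MvPolynomial

variable {σ K : Type*} [Field K]

theorem exists_pow_char_eq_of_pderiv_eq_zero (p : ℕ) [Fact p.Prime] [CharP K p] [PerfectRing K p]
    {f : MvPolynomial σ K} (hf : ∀ i, pderiv i f = 0) : ∃ g : MvPolynomial σ K, g ^ p = f := by
  have hp : p.Prime := Fact.out
  have hdvd : ∀ m ∈ f.support, ∀ i, p ∣ m i := by
    intro m hm i
    by_cases h0 : m i = 0
    · simp [h0]
    have h1 := coeff_pderiv (i := i) f (m - Finsupp.single i 1)
    have h2 : m - Finsupp.single i 1 + Finsupp.single i 1 = m :=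
      tsub_add_cancel_of_le (Finsupp.single_le_iff.2 (Nat.one_le_iff_ne_zero.2 h0))
    rw [hf i, h2, coeff_zero, eq_comm, mul_eq_zero] at h1
    have h3 := h1.resolve_left (mem_support_iff.1 hm)
    rw [← CharP.cast_eq_zero_iff K p, ← h3]
    simp [Nat.cast_sub (Nat.one_le_iff_ne_zero.2 h0)]
  refine ⟨∑ m ∈ f.support, monomial (m.mapRange (· / p) (Nat.zero_div p))
    ((frobeniusEquiv K p).symm (coeff m f)), ?_⟩
  rw [sum_pow_char]
  conv_rhs => rw [f.as_sum]
  refine Finset.sum_congr rfl fun m hm => ?_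
  rw [monomial_pow]
  congr 1
  · congr 1
    ext i
    simp [Nat.mul_div_cancel' (hdvd m hm i)]
  · simp [← frobenius_def]

theorem exists_totalDegree_le_forall_eval_eq_zero [Fintype σ] {S : Set (σ → K)} (hS : S.Finite)
    {e : ℕ} (hcard : S.ncard < (e + 1) ^ Fintype.card σ) :
    ∃ f : MvPolynomial σ K, f ≠ 0 ∧ f.totalDegree ≤ Fintype.card σ * e ∧
      ∀ a ∈ S, eval a f = 0 := by
  classical
  have := hS.fintype
  let mon : (σ → Fin (e + 1)) → σ →₀ ℕ := fun a => Finsupp.equivFunOnFinite.symm fun i => (a i : ℕ)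
  have hmon : Function.Injective mon := fun a b h => by
    ext i
    exact DFunLike.congr_fun h i
  let T : ((σ → Fin (e + 1)) → K) →ₗ[K] MvPolynomial σ K :=
    ∑ a, (monomial (mon a)).comp (LinearMap.proj a)
  let ev : MvPolynomial σ K →ₗ[K] (S → K) := LinearMap.pi fun a => (aeval (R := K) a.1).toLinearMap
  have hT : ∀ c, T c = ∑ a, monomial (mon a) (c a) := fun c => by simp [T]
  have hker : LinearMap.ker (ev ∘ₗ T) ≠ ⊥ := by
    apply LinearMap.ker_ne_bot_of_finrank_lt
    rw [Set.ncard_eq_toFinset_card', Set.toFinset_card] at hcard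
    simpa using hcard
  obtain ⟨c, hc, hc0⟩ := (Submodule.ne_bot_iff _).1 hker
  refine ⟨T c, ?_, ?_, ?_⟩
  · contrapose! hc0
    ext a
    have h := congrArg (coeff (mon a)) hc0
    rw [hT, coeff_sum] at h
    simpa [coeff_monomial, hmon.eq_iff] using h
  · rw [hT]
    refine totalDegree_finsetSum_le fun a _ => (totalDegree_monomial_le _ _).trans ?_
    rw [Finsupp.sum_fintype _ _ (fun _ => rfl)]
    calc _ ≤ ∑ _i : σ, e := Finset.sum_le_sum fun i _ => Nat.lt_succ_iff.1 (a i).2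
      _ = _ := by simp
  · intro a ha
    have h := congrFun (LinearMap.mem_ker.1 hc) ⟨a, ha⟩
    simpa [ev, aeval_eq_eval] using h

theorem totalDegree_pderiv_lt {f : MvPolynomial σ K} {i : σ} (h : pderiv i f ≠ 0) :
    (pderiv i f).totalDegree < f.totalDegree := by
  classical
  obtain ⟨m, hm, hdeg⟩ := Finset.exists_mem_eq_sup (pderiv i f).support
    (support_nonempty.2 h) fun s => s.sum fun _ e => e
  have hmem : m + Finsupp.single i 1 ∈ f.support := by
    rw [mem_support_iff] at hm ⊢
    rw [coeff_pderiv] at hm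
    exact left_ne_zero_of_mul hm
  have hle := le_totalDegree hmem
  rw [Finsupp.sum_add_index' (fun _ => rfl) (fun _ _ _ => rfl), Finsupp.sum_single_index rfl] at hle
  have : (pderiv i f).totalDegree = m.sum fun _ e => e := hdeg
  omega

theorem exists_eval_pderiv_ne_zero [Fintype σ] (p : ℕ) [Fact p.Prime] [CharP K p] [PerfectRing K p]
    {S : Set (σ → K)} (hS : S.Finite) (hne : S.Nonempty)
    {e : ℕ} (hcard : S.ncard < (e + 1) ^ Fintype.card σ) :
    ∃ f : MvPolynomial σ K, f.totalDegree ≤ Fintype.card σ * e ∧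
      (∀ a ∈ S, eval a f = 0) ∧ ∃ a ∈ S, ∃ i, eval a (pderiv i f) ≠ 0 := by
  obtain ⟨f₀, hf₀, hdeg₀, hev₀⟩ := exists_totalDegree_le_forall_eval_eq_zero hS hcard
  obtain ⟨f, ⟨hf, hev⟩, hmin⟩ := exists_minimalFor_of_wellFoundedLT
    (fun f : MvPolynomial σ K => f ≠ 0 ∧ ∀ a ∈ S, eval a f = 0) totalDegree ⟨f₀, hf₀, hev₀⟩
  have hmin' : ∀ g : MvPolynomial σ K, g ≠ 0 → (∀ a ∈ S, eval a g = 0) →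
      f.totalDegree ≤ g.totalDegree := fun g h0 h1 =>
    (le_total f.totalDegree g.totalDegree).elim id fun h => hmin ⟨h0, h1⟩ h
  refine ⟨f, (hmin' f₀ hf₀ hev₀).trans hdeg₀, hev, ?_⟩
  by_contra! hcon
  have hpd : ∀ i, pderiv i f = 0 := fun i => by
    by_contra h
    exact (totalDegree_pderiv_lt h).not_ge (hmin' _ h fun a ha => hcon a ha i)
  obtain ⟨g, rfl⟩ := exists_pow_char_eq_of_pderiv_eq_zero p hpd
  have hp : 2 ≤ p := (Fact.out : p.Prime).two_le
  have hg : g ≠ 0 := by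
    rintro rfl
    exact hf (zero_pow (by omega))
  have h1 := hmin' g hg fun a ha => by simpa [show p ≠ 0 by omega] using hev a ha
  have h2 : (g ^ p).totalDegree = g.totalDegree + (g.totalDegree + (g ^ (p - 2)).totalDegree) := by
    rw [← totalDegree_mul_of_isDomain hg (pow_ne_zero _ hg),
      ← totalDegree_mul_of_isDomain hg (mul_ne_zero hg (pow_ne_zero _ hg)), ← mul_assoc, ← sq,
      ← pow_add, Nat.add_sub_cancel' hp]
  have h3 : (g ^ p).totalDegree = 0 := by
    have := totalDegree_pow g p
    rw [show g.totalDegree = 0 by omega] at this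
    omega
  obtain ⟨a, ha⟩ := hne
  have h4 := hev a ha
  rw [totalDegree_eq_zero_iff_eq_C.1 h3, eval_C] at h4
  rw [totalDegree_eq_zero_iff_eq_C.1 h3, h4, C_0] at hf
  exact hf rfl

theorem sum_mul_eval_pderiv_eq_zero [Fintype σ] [Infinite K] {f : MvPolynomial σ K} {a v : σ → K}
    (h : ∀ t : K, eval (fun i => a i + t * v i) f = 0) :
    ∑ i, v i * eval a (pderiv i f) = 0 := by
  classical
  let u : MvPolynomial σ K →ₐ[K] Polynomial K :=
    aeval fun i => Polynomial.C (a i) + Polynomial.C (v i) * Polynomial.X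
  have hu : ∀ (g : MvPolynomial σ K) (t : K),
      (u g).eval t = eval (fun i => a i + t * v i) g := fun g t => by
    induction g using MvPolynomial.induction_on with
    | C c => simp [u]
    | add g₁ g₂ h₁ h₂ => simp [h₁, h₂]
    | mul_X g i hg =>
      rw [map_mul, Polynomial.eval_mul, hg]
      simp [u, mul_comm t]
  have hder : ∀ g : MvPolynomial σ K,
      (Polynomial.derivative (u g)).eval 0 = ∑ i, v i * eval a (pderiv i g) := fun g => by
    induction g using MvPolynomial.induction_on with
    | C c => simp [u]
    | add g₁ g₂ h₁ h₂ => simp [h₁, h₂, mul_add, Finset.sum_add_distrib]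
    | mul_X g j hg =>
      have h0 := hu g 0
      simp only [zero_mul, add_zero] at h0
      simp only [map_mul, Polynomial.derivative_mul, Polynomial.eval_add, Polynomial.eval_mul, hg,
        h0, Derivation.leibniz, smul_eq_mul, eval_X, map_add, mul_add, Finset.sum_add_distrib]
      rw [add_comm]
      congr 1
      · rw [Finset.sum_eq_single j]
        · rw [pderiv_X_self, map_one, mul_one, mul_comm]
          simp [u]
        · intro i _ hi
          simp [pderiv_X_of_ne hi.symm]
        · simp
      · simp [u, Finset.sum_mul]
        exact Finset.sum_congr rfl fun i _ => by ring
  rw [← hder, show u f = 0 from Polynomial.funext fun t => by simp [hu, h]]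
  simp

theorem exists_homogenization {n : ℕ} (f : MvPolynomial σ K) (A : σ → Fin n → K) (B : Fin n → K) :
    ∃ G : MvPolynomial (Fin n) K, G.totalDegree ≤ f.totalDegree ∧
      ∀ s : Fin n → K, ∑ m, B m * s m ≠ 0 →
        eval s G = (∑ m, B m * s m) ^ f.totalDegree *
          eval (fun i => (∑ m, A i m * s m) / ∑ m, B m * s m) f := by
  let lin : (Fin n → K) → MvPolynomial (Fin n) K := fun c => ∑ m, C (c m) * X m
  have hlin : ∀ c, (lin c).totalDegree ≤ 1 := fun c =>
    totalDegree_finsetSum_le fun m _ => (totalDegree_mul _ _).trans (by simp)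
  have hev : ∀ c s, eval s (lin c) = ∑ m, c m * s m := fun c s => by simp [lin]
  refine ⟨∑ m ∈ f.support, C (coeff m f) * ((m.prod fun i j => lin (A i) ^ j) *
    lin B ^ (f.totalDegree - m.sum fun _ j => j)), ?_, ?_⟩
  · refine totalDegree_finsetSum_le fun m hm => (totalDegree_mul _ _).trans ?_
    rw [totalDegree_C, zero_add]
    refine (totalDegree_mul _ _).trans ?_
    have h1 : (m.prod fun i j => lin (A i) ^ j).totalDegree ≤ m.sum fun _ j => j := by
      refine (totalDegree_finsetProd _ _).trans (Finset.sum_le_sum fun i _ => ?_)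
      exact (totalDegree_pow _ _).trans (by nlinarith [hlin (A i)])
    have h2 : (lin B ^ (f.totalDegree - m.sum fun _ j => j)).totalDegree ≤
        f.totalDegree - m.sum fun _ j => j :=
      (totalDegree_pow _ _).trans (by nlinarith [hlin B])
    have := le_totalDegree hm
    omega
  · intro s hs
    rw [eval_eq _ f, map_sum, Finset.mul_sum]
    refine Finset.sum_congr rfl fun m hm => ?_
    have hle := le_totalDegree hm
    rw [map_mul, map_mul, eval_C, map_pow, hev, Finsupp.prod, map_prod, mul_left_comm (_ ^ _)]
    congr 1
    simp only [map_pow, hev, div_pow, Finset.prod_div_distrib]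
    rw [Finset.prod_pow_eq_pow_sum, mul_div_left_comm]
    congr 1
    rw [eq_div_iff (pow_ne_zero _ hs), ← pow_add]
    congr 1
    exact Nat.sub_add_cancel hle

end MvPolynomial

theorem exists_forall_mem_iff_sum_mul_eq_zero {F K : Type*} [Field F] [Field K]
    [Algebra F K] {p ℓ : Submodule F K} {k : ℕ} (hpℓ : p ≤ ℓ)
    (b : Module.Basis (Fin (k + 1)) F ℓ) (hp : Module.finrank F p = k) :
    ∃ s : Fin (k + 1) → F, s ≠ 0 ∧ ∀ x : ℓ, (x : K) ∈ p ↔ ∑ m, s m * b.repr x m = 0 := by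
  have : Module.Finite F ℓ := Module.Finite.of_basis b
  have hℓ : Module.finrank F ℓ = k + 1 := by simpa using Module.finrank_eq_card_basis b
  have hp' : Module.finrank F (p.comap ℓ.subtype) = k := by
    rw [← hp]
    exact (Submodule.comapSubtypeEquivOfLe hpℓ).finrank_eq
  have hlt : p.comap ℓ.subtype < ⊤ := by
    rw [lt_top_iff_ne_top]
    intro h
    rw [h, finrank_top] at hp'
    omega
  obtain ⟨h, h0, hle⟩ := Submodule.exists_le_ker_of_lt_top _ hlt
  have hker : p.comap ℓ.subtype = LinearMap.ker h := by
    refine Submodule.eq_of_le_of_finrank_le hle ?_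
    have := Module.Dual.finrank_ker_add_one_of_ne_zero h0
    omega
  have hs : ∀ x : ℓ, h x = ∑ m, h (b m) * b.repr x m := fun x => by
    have := congrArg h (b.sum_repr x)
    simp only [map_sum, map_smul, smul_eq_mul] at this
    rw [← this]
    exact Finset.sum_congr rfl fun m _ => mul_comm _ _
  refine ⟨fun m => h (b m), fun hcon => h0 ?_, fun x => ?_⟩
  · ext x
    rw [hs]
    simp [fun m => congrFun hcon m]
  · rw [← hs, ← LinearMap.mem_ker, ← hker]
    rfl

section Frobenius

variable {F K : Type*} [Field F] [Fintype F] [Field K] [Algebra F K]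

local notation "q" => Fintype.card F

theorem eq_zero_of_sum_mul_pow_card_pow_eq_zero {S : Submodule F K} {m : ℕ}
    (hm : m ≤ Module.finrank F S) {c : Fin m → K}
    (hc : ∀ x ∈ S, ∑ i, c i * x ^ q ^ (i : ℕ) = 0) : c = 0 := by
  classical
  rcases Nat.eq_zero_or_pos m with rfl | hpos
  · exact Subsingleton.elim _ _
  have hq : 1 < q := Fintype.one_lt_card
  have : Module.Finite F S := Module.finite_of_finrank_pos (by omega)
  have : Finite S := Module.finite_of_finite F
  have := Fintype.ofFinite S
  let P : Polynomial K := ∑ i : Fin m, Polynomial.monomial (q ^ (i : ℕ)) (c i)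
  have hP : P = 0 := by
    refine Polynomial.eq_zero_of_natDegree_lt_card_of_eval_eq_zero P
      (f := ((↑) : S → K)) Subtype.val_injective (fun x => ?_) ?_
    · simpa [P, Polynomial.eval_finsetSum] using hc x x.2
    · rw [Module.card_eq_pow_finrank (K := F) (V := S)]
      refine lt_of_le_of_lt (b := q ^ (m - 1)) ?_ (Nat.pow_lt_pow_right hq (by omega))
      refine Polynomial.natDegree_sum_le_of_forall_le _ _ fun i _ => ?_
      exact (Polynomial.natDegree_monomial_le _).trans (Nat.pow_le_pow_right hq.le (by omega))
  ext i
  have h := congrArg (fun Q => Polynomial.coeff Q (q ^ (i : ℕ))) hP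
  simpa [P, Polynomial.finsetSum_coeff, Polynomial.coeff_monomial,
    Nat.pow_right_inj hq, Fin.val_inj] using h

theorem eq_of_forall_sum_mul_pow_card_pow_eq {S : Submodule F K} {m : ℕ}
    (hm : m ≤ Module.finrank F S) {c c' : Fin m → K}
    (hc : ∀ x ∈ S, ∑ i, c i * x ^ q ^ (i : ℕ) = ∑ i, c' i * x ^ q ^ (i : ℕ)) : c = c' := by
  refine sub_eq_zero.1 (eq_zero_of_sum_mul_pow_card_pow_eq_zero hm fun x hx => ?_)
  simp [sub_mul, hc x hx]

theorem exists_forall_eq_sum_mul_pow_card_pow {S : Submodule F K} [Module.Finite F S] {m : ℕ}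
    (hm : Module.finrank F S = m) (g : S →ₗ[F] K) :
    ∃ c : Fin m → K, ∀ x : S, g x = ∑ i, c i * (x : K) ^ q ^ (i : ℕ) := by
  let φ : Fin m → S →ₗ[F] K := fun i =>
    ((FiniteField.frobeniusAlgHom F K) ^ (i : ℕ)).toLinearMap ∘ₗ S.subtype
  have hφ : ∀ i x, φ i x = (x : K) ^ q ^ (i : ℕ) := fun i x => by
    simp [φ, AlgHom.coe_pow, FiniteField.coe_frobeniusAlgHom, pow_iterate]
  have hli : LinearIndependent K φ := by
    rw [Fintype.linearIndependent_iff]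
    intro c hc
    refine congrFun (eq_zero_of_sum_mul_pow_card_pow_eq_zero hm.ge fun x hx => ?_)
    have := LinearMap.congr_fun hc ⟨x, hx⟩
    simpa [hφ] using this
  have hspan := hli.span_eq_top_of_card_eq_finrank' (by
    rw [Module.finrank_linearMap_self, hm, Fintype.card_fin])
  have hg : g ∈ Submodule.span K (Set.range φ) := hspan ▸ Submodule.mem_top
  obtain ⟨c, hc⟩ := (Submodule.mem_span_range_iff_exists_fun K).1 hg
  refine ⟨c, fun x => ?_⟩
  rw [← hc]
  simp [hφ]

theorem exists_forall_pow_card_pow_eq {S : Submodule F K} [Module.Finite F S] {m : ℕ}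
    (hm : Module.finrank F S = m) (n : ℕ) :
    ∃ c : Fin m → K, ∀ x ∈ S, x ^ q ^ n = ∑ i, c i * x ^ q ^ (i : ℕ) := by
  obtain ⟨c, hc⟩ := exists_forall_eq_sum_mul_pow_card_pow hm
    (((FiniteField.frobeniusAlgHom F K) ^ n).toLinearMap ∘ₗ S.subtype)
  refine ⟨c, fun x hx => ?_⟩
  rw [← hc ⟨x, hx⟩]
  simp [AlgHom.coe_pow, FiniteField.coe_frobeniusAlgHom, pow_iterate]

theorem eval_eq_zero_of_forall_hyperplane {σ : Type*} {f : MvPolynomial σ K} {k : ℕ}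
    {ℓ : Submodule F K} (hℓ : Module.finrank F ℓ = k + 1) {H : Finset (Submodule F K)}
    (hle : ∀ p ∈ H, p ≤ ℓ) (hH : ∀ p ∈ H, Module.finrank F p = k)
    {w : Submodule F K → Fin k → K}
    (hw : ∀ p ∈ H, ∀ x ∈ p, x ^ q ^ k = ∑ j, w p j * x ^ q ^ (j : ℕ))
    {E : σ → K} {V : σ → Fin k → K}
    (hf : ∀ p ∈ H, MvPolynomial.eval (fun i => E i + ∑ j, V i j * w p j) f = 0)
    (hcard : f.totalDegree * q ^ k < (q - 1) * H.card) (y : Fin k → K) :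
    MvPolynomial.eval (fun i => E i + ∑ j, V i j * y j) f = 0 := by
  classical
  have hq : 1 < q := Fintype.one_lt_card
  have : Module.Finite F ℓ := Module.finite_of_finrank_pos (by omega)
  let b : Module.Basis (Fin (k + 1)) F ℓ := Module.finBasisOfFinrankEq F ℓ hℓ
  choose c hc using fun m => exists_forall_eq_sum_mul_pow_card_pow hℓ
    ((Algebra.linearMap F K) ∘ₗ b.coord m)
  have hc : ∀ m (x : ℓ), algebraMap F K (b.repr x m) = ∑ j, c m j * (x : K) ^ q ^ (j : ℕ) :=
    fun m x => by simpa using hc m x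
  obtain ⟨G, hGdeg, hG⟩ := f.exists_homogenization
    (fun i m => E i * c m (Fin.last k) - ∑ j : Fin k, V i j * c m j.castSucc)
    (fun m => c m (Fin.last k))
  have hG' : ∀ (s : Fin (k + 1) → K) (z : Fin k → K), ∑ m, c m (Fin.last k) * s m ≠ 0 →
      (∀ j : Fin k, ∑ m, c m j.castSucc * s m = -z j * ∑ m, c m (Fin.last k) * s m) →
      MvPolynomial.eval s G = (∑ m, c m (Fin.last k) * s m) ^ f.totalDegree *
        MvPolynomial.eval (fun i => E i + ∑ j, V i j * z j) f := by
    intro s z hs hz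
    rw [hG s hs]
    congr 3
    ext i
    rw [div_eq_iff hs, add_mul, Finset.sum_mul]
    simp only [sub_mul, Finset.sum_sub_distrib, mul_assoc, ← Finset.mul_sum, Finset.sum_mul]
    rw [Finset.sum_comm, sub_eq_add_neg, ← Finset.sum_neg_distrib]
    congr 1
    refine Finset.sum_congr rfl fun j _ => ?_
    simp only [← Finset.mul_sum]
    rw [hz]
    ring
  have hG0 : G = 0 := by
    by_contra hne
    have hinj : Function.Injective (algebraMap F K) := (algebraMap F K).injective
    have hSZ := MvPolynomial.schwartz_zippel_totalDegree hne
      (Finset.univ.image (algebraMap F K))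
    rw [Finset.card_image_of_injective _ hinj, Finset.card_univ, div_le_div_iff₀ (by positivity)
      (by positivity), pow_succ, ← mul_assoc, mul_le_mul_iff_left₀ (by positivity)] at hSZ
    norm_cast at hSZ
    choose! s hs0 hs using fun (p : Submodule F K) (hp : p ∈ H) =>
      exists_forall_mem_iff_sum_mul_eq_zero (hle p hp) b (hH p hp)
    refine (hSZ.trans (Nat.mul_le_mul_right _ hGdeg)).not_gt (hcard.trans_le ?_)
    have hunits : (Finset.univ : Finset Fˣ).card = q - 1 := by
      rw [Finset.card_univ, Fintype.card_units]
    rw [← hunits, ← Finset.card_product]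
    refine Finset.card_le_card_of_injOn
      (fun tp m => algebraMap F K ((tp.1 : F) * s tp.2 m)) ?_ ?_
    · rintro ⟨t, p⟩ htp
      have hp : p ∈ H := by simpa using htp
      have hval : ∀ x : ℓ, ∑ j, (∑ m, c m j * algebraMap F K (t * s p m)) *
          (x : K) ^ q ^ (j : ℕ) = algebraMap F K (t * ∑ m, s p m * b.repr x m) := by
        intro x
        simp only [Finset.sum_mul, Finset.mul_sum, map_sum, map_mul, hc]
        rw [Finset.sum_comm]
        refine Finset.sum_congr rfl fun m _ => Finset.sum_congr rfl fun j _ => ?_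
        ring
      set a : Fin (k + 1) → K := fun j => ∑ m, c m j * algebraMap F K (t * s p m) with ha
      have hvanish : ∀ x ∈ p, ∑ j, a j * x ^ q ^ (j : ℕ) = 0 := by
        intro x hx
        have h1 := hval ⟨x, hle p hp hx⟩
        rw [(hs p hp ⟨x, hle p hp hx⟩).1 hx] at h1
        rwa [mul_zero, map_zero] at h1
      have hlast : a (Fin.last k) ≠ 0 := by
        intro h0
        have h1 : (fun j : Fin k => a j.castSucc) = 0 := by
          refine eq_zero_of_sum_mul_pow_card_pow_eq_zero (hH p hp).ge fun x hx => ?_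
          have := hvanish x hx
          rw [Fin.sum_univ_castSucc, h0] at this
          simpa using this
        have h2 : ∀ j, a j = 0 := fun j => Fin.lastCases h0 (fun j => congrFun h1 j) j
        apply hs0 p hp
        ext m
        have h3 : algebraMap F K (t * ∑ m', s p m' * b.repr (b m) m') = 0 := by
          rw [← hval]
          exact Finset.sum_eq_zero fun j _ => mul_eq_zero_of_left (h2 j) _
        simpa [Finsupp.single_apply] using h3
      have h5 : MvPolynomial.eval (fun m => algebraMap F K (t * s p m)) G = 0 := by
        rw [hG' _ (w p) hlast, hf p hp, mul_zero]
        have h6 : (fun j : Fin k => a j.castSucc) = fun j => -w p j * a (Fin.last k) := by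
          refine eq_of_forall_sum_mul_pow_card_pow_eq (hH p hp).ge fun x hx => ?_
          have h7 := hvanish x hx
          rw [Fin.sum_univ_castSucc, Fin.val_last, hw p hp x hx] at h7
          simp only [Fin.val_castSucc] at h7
          rw [eq_neg_of_add_eq_zero_left h7, Finset.mul_sum, ← Finset.sum_neg_distrib]
          refine Finset.sum_congr rfl fun j _ => ?_
          ring
        exact congrFun h6
      exact Finset.mem_coe.2 (Finset.mem_filter.2 ⟨Fintype.mem_piFinset.2 fun m =>
        Finset.mem_image_of_mem _ (Finset.mem_univ _), h5⟩)
    · rintro ⟨t, p⟩ htp ⟨t', p'⟩ htp' heq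
      have hp : p ∈ H := by simpa using htp
      have hp' : p' ∈ H := by simpa using htp'
      have heq' : ∀ m, (t : F) * s p m = t' * s p' m := fun m => hinj (congrFun heq m)
      have hpp : p = p' := by
        have key : ∀ x : ℓ, (x : K) ∈ p ↔ (x : K) ∈ p' := by
          intro x
          rw [hs p hp, hs p' hp', ← (Units.isUnit t).mul_right_eq_zero,
            ← (Units.isUnit t').mul_right_eq_zero (b := ∑ m, s p' m * b.repr x m)]
          simp only [Finset.mul_sum, ← mul_assoc, heq']
        ext x
        exact ⟨fun hx => (key ⟨x, hle p hp hx⟩).1 hx, fun hx => (key ⟨x, hle p' hp' hx⟩).2 hx⟩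
      subst hpp
      obtain ⟨m, hm⟩ := Function.ne_iff.1 (hs0 p hp)
      have : t = t' := Units.ext (mul_right_cancel₀ hm (heq' m))
      rw [this]
  let Φ : (Fin (k + 1) → K) →ₗ[K] (Fin (k + 1) → K) := Matrix.mulVecLin fun j m => c m j
  have hΦ : ∀ s j, Φ s j = ∑ m, c m j * s m := fun s j => rfl
  have hΦinj : Function.Injective Φ := by
    rw [injective_iff_map_eq_zero]
    intro s hs
    ext m
    have h1 : ∑ j, Φ s j * (b m : K) ^ q ^ (j : ℕ) = s m := by
      simp only [hΦ, Finset.sum_mul]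
      rw [Finset.sum_comm, Finset.sum_eq_single m]
      · have := hc m (b m)
        rw [Module.Basis.repr_self, Finsupp.single_eq_same, map_one] at this
        calc _ = s m * ∑ j, c m j * (b m : K) ^ q ^ (j : ℕ) := by
              rw [Finset.mul_sum]
              exact Finset.sum_congr rfl fun j _ => by ring
          _ = s m := by rw [← this, mul_one]
      · intro m' _ hm'
        have := hc m' (b m)
        rw [Module.Basis.repr_self, Finsupp.single_eq_of_ne hm', map_zero] at this
        calc _ = s m' * ∑ j, c m' j * (b m : K) ^ q ^ (j : ℕ) := by
              rw [Finset.mul_sum]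
              exact Finset.sum_congr rfl fun j _ => by ring
          _ = 0 := by rw [← this, mul_zero]
      · simp
    rw [← h1, hs]
    simp
  obtain ⟨s, hs⟩ := LinearMap.surjective_of_injective hΦinj (Fin.snoc (fun j => -y j) 1)
  have hlast : ∑ m, c m (Fin.last k) * s m = 1 := by rw [← hΦ, hs, Fin.snoc_last]
  have h := hG' s y (by rw [hlast]; exact one_ne_zero) fun j => by
    rw [← hΦ, hs, Fin.snoc_castSucc, hlast, mul_one]
  rw [hG0, hlast] at h
  simpa using h.symm

open Classical in
theorem pow_le_card_of_le_finrank_iSup [IsAlgClosed K] {k r e : ℕ} (hk : 0 < k)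
    {P L : Finset (Submodule F K)} (hP : P.Nonempty)
    (hPk : ∀ p ∈ P, Module.finrank F p = k) (hLk : ∀ ℓ ∈ L, Module.finrank F ℓ = k + 1)
    (hL : ∀ ℓ ∈ L, r * k * e * q ^ k < (q - 1) * (P.filter (· ≤ ℓ)).card)
    (hspan : ∀ p ∈ P, k + r ≤ Module.finrank F (⨆ ℓ ∈ L.filter (p ≤ ·), ℓ : Submodule F K)) :
    (e + 1) ^ (r * k) ≤ P.card := by
  by_contra! hcard
  have hfin : ∀ p ∈ P, Module.Finite F p := fun p hp =>
    Module.finite_of_finrank_pos (by rw [hPk p hp]; exact hk)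
  have hfinL : ∀ ℓ ∈ L, Module.Finite F ℓ := fun ℓ hℓ =>
    Module.finite_of_finrank_pos (by rw [hLk ℓ hℓ]; exact k.succ_pos)
  choose! w hw using fun p hp =>
    have := hfin p hp
    exists_forall_pow_card_pow_eq (hPk p hp) k
  choose! M hM using fun p hp (i : Fin r) =>
    have := hfin p hp
    exists_forall_pow_card_pow_eq (hPk p hp) (k + i)
  choose! c hc using fun ℓ hℓ (i : Fin r) =>
    have := hfinL ℓ hℓ
    exists_forall_pow_card_pow_eq (hLk ℓ hℓ) (k + i)
  have hMc : ∀ p ∈ P, ∀ ℓ ∈ L, p ≤ ℓ → ∀ i j,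
      M p i j = c ℓ i j.castSucc + c ℓ i (Fin.last k) * w p j := by
    intro p hp ℓ hℓ hle i
    refine congrFun (eq_of_forall_sum_mul_pow_card_pow_eq (hPk p hp).ge fun x hx => ?_)
    rw [← hM p hp i x hx, hc ℓ hℓ i x (hle hx), Fin.sum_univ_castSucc, Fin.val_last,
      hw p hp x hx, Finset.mul_sum, ← Finset.sum_add_distrib]
    refine Finset.sum_congr rfl fun j _ => ?_
    rw [Fin.val_castSucc]
    ring
  obtain ⟨ch, hch⟩ := CharP.exists F
  have : Fact ch.Prime := ⟨CharP.char_is_prime F ch⟩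
  have : CharP K ch := charP_of_injective_algebraMap (algebraMap F K).injective ch
  have hPM : (Function.uncurry ∘ M '' (P : Set (Submodule F K))).ncard <
      (e + 1) ^ Fintype.card (Fin r × Fin k) := by
    refine (Set.ncard_image_le P.finite_toSet).trans_lt ?_
    simpa using hcard
  obtain ⟨f, hdeg, hf, a, ⟨p, hp, rfl⟩, ⟨i₀, j₀⟩, hne⟩ :=
    MvPolynomial.exists_eval_pderiv_ne_zero ch (P.finite_toSet.image _)
      (Set.Nonempty.image _ (Finset.coe_nonempty.2 hP)) hPM
  have hp : p ∈ P := hp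
  have hvanish : ∀ ℓ ∈ L, ∀ y : Fin k → K, MvPolynomial.eval
      (fun ij : Fin r × Fin k => c ℓ ij.1 ij.2.castSucc + c ℓ ij.1 (Fin.last k) * y ij.2) f =
        0 := by
    intro ℓ hℓ y
    have h := eval_eq_zero_of_forall_hyperplane (hLk ℓ hℓ) (f := f) (H := P.filter (· ≤ ℓ)) (w := w)
      (E := fun ij : Fin r × Fin k => c ℓ ij.1 ij.2.castSucc)
      (V := fun ij j => if ij.2 = j then c ℓ ij.1 (Fin.last k) else 0)
      (fun p' hp' => (Finset.mem_filter.1 hp').2)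
      (fun p' hp' => hPk p' (Finset.mem_filter.1 hp').1)
      (fun p' hp' => hw p' (Finset.mem_filter.1 hp').1) (fun p' hp' => ?_)
      (lt_of_le_of_lt (Nat.mul_le_mul_right _ (by simpa using hdeg)) (hL ℓ hℓ)) y
    · simpa using h
    · obtain ⟨hp', hle⟩ := Finset.mem_filter.1 hp'
      have h := hf _ ⟨p', hp', rfl⟩
      convert h using 2
      congr 1
      funext ij
      simp [hMc p' hp' ℓ hℓ hle, Function.uncurry]
  let d : Fin r → K := fun i =>
    MvPolynomial.eval (Function.uncurry (M p)) (MvPolynomial.pderiv (i, j₀) f)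
  have hd : ∀ ℓ ∈ L, p ≤ ℓ → ∑ i, c ℓ i (Fin.last k) * d i = 0 := by
    intro ℓ hℓ hle
    have : Infinite K := inferInstance
    have h := MvPolynomial.sum_mul_eval_pderiv_eq_zero (f := f) (a := Function.uncurry (M p))
      (v := fun ij => if ij.2 = j₀ then c ℓ ij.1 (Fin.last k) else 0) fun t => ?_
    · simpa [Fintype.sum_prod_type, d] using h
    · convert hvanish ℓ hℓ (fun j => w p j + if j = j₀ then t else 0) using 3
      funext ij
      simp only [Function.uncurry, hMc p hp ℓ hℓ hle]
      split_ifs <;> ring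
  let C : Fin (k + r) → K := Fin.append (fun j => -∑ i, d i * M p i j) d
  have hC : C = 0 := by
    refine eq_zero_of_sum_mul_pow_card_pow_eq_zero (hspan p hp) fun x hx => ?_
    let φ : K →ₗ[F] K := ∑ i, C i • ((FiniteField.frobeniusAlgHom F K) ^ (i : ℕ)).toLinearMap
    have hφ : ∀ x, φ x = ∑ i, C i * x ^ q ^ (i : ℕ) := fun x => by
      simp [φ, AlgHom.coe_pow, FiniteField.coe_frobeniusAlgHom, pow_iterate]
    rw [← hφ, ← LinearMap.mem_ker]
    refine (iSup₂_le fun ℓ hℓ x hx => ?_ : (⨆ ℓ ∈ L.filter (p ≤ ·), ℓ) ≤ LinearMap.ker φ) hx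
    obtain ⟨hℓ, hle⟩ := Finset.mem_filter.1 hℓ
    rw [LinearMap.mem_ker, hφ, Fin.sum_univ_add]
    simp only [C, Fin.append_left, Fin.append_right, Fin.val_castAdd, Fin.val_natAdd]
    have h1 : ∀ i : Fin r, x ^ q ^ (k + (i : ℕ)) = ∑ j, M p i j * x ^ q ^ (j : ℕ) +
        c ℓ i (Fin.last k) * (x ^ q ^ k - ∑ j, w p j * x ^ q ^ (j : ℕ)) := by
      intro i
      rw [hc ℓ hℓ i x hx, Fin.sum_univ_castSucc]
      simp only [hMc p hp ℓ hℓ hle, add_mul, Finset.sum_add_distrib, mul_sub, Finset.mul_sum,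
        mul_assoc, Fin.val_castSucc, Fin.val_last]
      ring
    simp only [h1, mul_add, Finset.sum_add_distrib, ← mul_assoc]
    rw [← Finset.sum_mul, Finset.sum_congr rfl fun i _ => mul_comm (d i) (c ℓ i (Fin.last k)),
      hd ℓ hℓ hle, zero_mul, add_zero]
    simp only [neg_mul, Finset.sum_neg_distrib, Finset.sum_mul, Finset.mul_sum]
    rw [Finset.sum_comm, neg_add_eq_zero]
    refine Finset.sum_congr rfl fun i _ => Finset.sum_congr rfl fun j _ => ?_
    ring
  have := congrFun hC (Fin.natAdd k i₀)
  simp only [C, Fin.append_right] at this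
  exact hne this

end Frobenius

theorem exists_subsets_forall_le_degree {α β : Type*} [DecidableEq α] [DecidableEq β]
    (R : α → β → Prop) [∀ x y, Decidable (R x y)] {a b : ℝ} (hb : 0 ≤ b)
    (P : Finset α) (L : Finset β)
    (h : a * P.card + b * L.card < ∑ ℓ ∈ L, ((P.filter (R · ℓ)).card : ℝ)) :
    ∃ P' ⊆ P, ∃ L' ⊆ L, P'.Nonempty ∧ (∀ p ∈ P', a ≤ ((L'.filter (R p ·)).card : ℝ)) ∧
      ∀ ℓ ∈ L', b ≤ ((P'.filter (R · ℓ)).card : ℝ) := by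
  induction hn : P.card + L.card using Nat.strong_induction_on generalizing P L with
  | _ n ih =>
  subst hn
  have hswap : ∀ (P : Finset α) (L : Finset β), ∑ ℓ ∈ L, ((P.filter (R · ℓ)).card : ℝ) =
      ∑ p ∈ P, ((L.filter (R p ·)).card : ℝ) := fun P L => by
    exact_mod_cast (Finset.sum_card_bipartiteAbove_eq_sum_card_bipartiteBelow R (s := P)
      (t := L)).symm
  by_cases hPdeg : ∀ p ∈ P, a ≤ ((L.filter (R p ·)).card : ℝ)
  · by_cases hLdeg : ∀ ℓ ∈ L, b ≤ ((P.filter (R · ℓ)).card : ℝ)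
    · refine ⟨P, subset_rfl, L, subset_rfl, ?_, hPdeg, hLdeg⟩
      by_contra hne
      rw [Finset.not_nonempty_iff_eq_empty] at hne
      subst hne
      simp only [Finset.filter_empty, Finset.card_empty, Nat.cast_zero, mul_zero, zero_add,
        Finset.sum_const_zero] at h
      exact h.not_ge (by positivity)
    · push Not at hLdeg
      obtain ⟨ℓ, hℓ, hlt⟩ := hLdeg
      have hc := Finset.card_erase_add_one hℓ
      obtain ⟨P', hP', L', hL', h'⟩ := ih _ (by omega) P (L.erase ℓ) (by
        rw [← Finset.add_sum_erase _ _ hℓ] at h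
        rw [← hc] at h
        push_cast at h
        linarith) rfl
      exact ⟨P', hP', L', hL'.trans (Finset.erase_subset _ _), h'⟩
  · push Not at hPdeg
    obtain ⟨p, hp, hlt⟩ := hPdeg
    have hc := Finset.card_erase_add_one hp
    obtain ⟨P', hP', L', hL', h'⟩ := ih _ (by omega) (P.erase p) L (by
      rw [hswap] at h ⊢
      rw [← Finset.add_sum_erase _ _ hp] at h
      rw [← hc] at h
      push_cast at h
      linarith) rfl
    exact ⟨P', hP'.trans (Finset.erase_subset _ _), L', hL', h'⟩

theorem card_mul_le_pow_finrank_iSup {F V : Type*} [Field F] [Fintype F] [AddCommGroup V]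
    [Module F V] {k : ℕ} {p : Submodule F V} (hp : Module.finrank F p = k)
    {L : Finset (Submodule F V)} (hL : ∀ ℓ ∈ L, Module.finrank F ℓ = k + 1)
    (hle : ∀ ℓ ∈ L, p ≤ ℓ) :
    L.card * (Fintype.card F ^ (k + 1) - Fintype.card F ^ k) ≤
      Fintype.card F ^ Module.finrank F (⨆ ℓ ∈ L, ℓ : Submodule F V) := by
  classical
  have hfin : ∀ ℓ ∈ L, Module.Finite F ℓ := fun ℓ hℓ =>
    Module.finite_of_finrank_pos (by rw [hL ℓ hℓ]; exact k.succ_pos)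
  set S : Submodule F V := ⨆ ℓ ∈ L, ℓ with hS
  have hSfin : Module.Finite F S := by
    rw [hS, iSup_subtype']
    have : ∀ ℓ : {ℓ // ℓ ∈ L}, Module.Finite F (ℓ : Submodule F V) := fun ℓ => hfin ℓ ℓ.2
    exact Submodule.finite_iSup _
  have hSfin' : Finite S := Module.finite_of_finite F
  have := Fintype.ofFinite S
  have hcard : ∀ T : Submodule F V, T ≤ S →
      (Finset.univ.filter fun x : S => (x : V) ∈ T).card = Fintype.card F ^ Module.finrank F T := by
    intro T hT
    have h1 := Module.natCard_eq_pow_finrank (K := F) (V := T.comap S.subtype)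
    rw [(Submodule.comapSubtypeEquivOfLe hT).finrank_eq, Nat.card_eq_fintype_card,
      Nat.card_eq_fintype_card] at h1
    rw [← h1, Fintype.card_subtype]
    rfl
  have hleS : ∀ ℓ ∈ L, ℓ ≤ S := fun ℓ hℓ => le_iSup₂_of_le ℓ hℓ le_rfl
  let T : Submodule F V → Finset S := fun ℓ =>
    (Finset.univ.filter fun x : S => (x : V) ∈ ℓ) \ Finset.univ.filter fun x : S => (x : V) ∈ p
  have hT : ∀ ℓ ∈ L, (T ℓ).card = Fintype.card F ^ (k + 1) - Fintype.card F ^ k := by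
    intro ℓ hℓ
    rw [Finset.card_sdiff_of_subset, hcard ℓ (hleS ℓ hℓ), hcard p ((hle ℓ hℓ).trans (hleS ℓ hℓ)),
      hL ℓ hℓ, hp]
    intro x hx
    simp only [Finset.mem_filter, Finset.mem_univ, true_and] at hx ⊢
    exact hle ℓ hℓ hx
  have hdisj : (L : Set (Submodule F V)).PairwiseDisjoint T := by
    intro ℓ hℓ ℓ' hℓ' hne
    refine Finset.disjoint_left.2 fun x hx hx' => hne ?_
    simp only [T, Finset.mem_sdiff, Finset.mem_filter, Finset.mem_univ, true_and] at hx hx'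
    have := hfin ℓ hℓ
    have := hfin ℓ' hℓ'
    have hlt : p < ℓ ⊓ ℓ' := lt_of_le_of_ne (le_inf (hle ℓ hℓ) (hle ℓ' hℓ')) fun h =>
      hx.2 (h ▸ ⟨hx.1, hx'.1⟩)
    have hrank := Submodule.finrank_lt_finrank_of_lt hlt
    rw [← Submodule.eq_of_le_of_finrank_le (inf_le_left : ℓ ⊓ ℓ' ≤ ℓ) (by rw [hL ℓ hℓ]; omega)]
    exact Submodule.eq_of_le_of_finrank_le (inf_le_right : ℓ ⊓ ℓ' ≤ ℓ') (by rw [hL ℓ' hℓ']; omega)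
  calc _ = ∑ ℓ ∈ L, (T ℓ).card := by rw [Finset.sum_congr rfl hT, Finset.sum_const, smul_eq_mul]
    _ = (L.biUnion T).card := (Finset.card_biUnion hdisj).symm
    _ ≤ (Finset.univ : Finset S).card := Finset.card_le_univ _
    _ = _ := by rw [Finset.card_univ, Module.card_eq_pow_finrank (K := F)]

/-- The linear span of `A × {1}`, the linear subspace cut out by the cone over `A`. -/
def affineCone (F : Type*) [Field F] {V : Type*} [AddCommGroup V] [Module F V] (A : Set V) :
    Submodule F (V × F) :=
  Submodule.span F ((fun x => (x, (1 : F))) '' A)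

theorem affineCone_mono {F V : Type*} [Field F] [AddCommGroup V] [Module F V] {A B : Set V}
    (h : A ⊆ B) : affineCone F A ≤ affineCone F B :=
  Submodule.span_mono (Set.image_mono h)

namespace IsPlane

variable {F V : Type*} [Field F] [AddCommGroup V] [Module F V] {k : ℕ} {A : Set V}

theorem finrank_affineCone_and_mem_iff [Module.Finite F V] (hA : IsPlane F k A) :
    Module.finrank F (affineCone F A) = k + 1 ∧ ∀ y, (y, (1 : F)) ∈ affineCone F A ↔ y ∈ A := by
  obtain ⟨x, W, hW, rfl⟩ := hA
  let ι : W × F →ₗ[F] V × F :=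
    (W.subtype.coprod (LinearMap.toSpanSingleton F V x)).prod (LinearMap.snd F W F)
  have hι : ∀ w t, ι (w, t) = ((w : V) + t • x, t) := fun w t => by simp [ι]
  have hinj : Function.Injective ι := by
    rintro ⟨w, t⟩ ⟨w', t'⟩ h
    rw [hι, hι, Prod.mk.injEq] at h
    obtain ⟨h, rfl⟩ := h
    simpa using h
  have hspan : affineCone F (x +ᵥ (W : Set V)) = LinearMap.range ι := by
    apply le_antisymm
    · rw [affineCone, Submodule.span_le]
      rintro _ ⟨_, ⟨w, hw, rfl⟩, rfl⟩
      exact ⟨(⟨w, hw⟩, 1), by simp [hι, add_comm]⟩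
    · rintro _ ⟨⟨w, t⟩, rfl⟩
      have hmem : ∀ w : W, ((x + w : V), (1 : F)) ∈ affineCone F (x +ᵥ (W : Set V)) := fun w =>
        Submodule.subset_span ⟨x + w, ⟨w, w.2, rfl⟩, rfl⟩
      have h := add_mem (sub_mem (hmem w) (hmem 0)) (Submodule.smul_mem _ t (hmem 0))
      convert h using 1
      simp [hι]
  refine ⟨?_, fun y => ?_⟩
  · rw [hspan, LinearMap.finrank_range_of_inj hinj, Module.finrank_prod, hW, Module.finrank_self]
  · rw [hspan]
    constructor
    · rintro ⟨⟨w, t⟩, h⟩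
      rw [hι, Prod.mk.injEq] at h
      obtain ⟨rfl, rfl⟩ := h
      exact ⟨w, w.2, by simp [add_comm]⟩
    · rintro ⟨w, hw, rfl⟩
      exact ⟨(⟨w, hw⟩, 1), by simp [hι, add_comm]⟩

end IsPlane

theorem affineCone_injOn {F V : Type*} [Field F] [AddCommGroup V] [Module F V] [Module.Finite F V]
    {k : ℕ} {𝒜 : Set (Set V)} (h : ∀ A ∈ 𝒜, IsPlane F k A) :
    Set.InjOn (affineCone F) 𝒜 := fun A hA B hB hAB => by
  ext y
  rw [← (h A hA).finrank_affineCone_and_mem_iff.2, hAB,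
    (h B hB).finrank_affineCone_and_mem_iff.2]

theorem exists_injective_linearMap_algebraicClosure (F V : Type*) [Field F] [Finite F]
    [AddCommGroup V] [Module F V] [Module.Finite F V] :
    ∃ φ : V →ₗ[F] AlgebraicClosure F, Function.Injective φ := by
  have hnot : ¬ Module.Finite F (AlgebraicClosure F) := fun h =>
    (Module.finite_of_finite F : Finite (AlgebraicClosure F)).false
  have hrank : Cardinal.aleph0 ≤ Module.rank F (AlgebraicClosure F) := by
    rwa [← not_lt, Module.rank_lt_aleph0_iff]
  obtain ⟨f, hf⟩ := Module.le_rank_iff_exists_linearMap.1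
    ((Cardinal.natCast_le_aleph0 (n := Module.finrank F V)).trans hrank)
  let e : V ≃ₗ[F] (Fin (Module.finrank F V) → F) := LinearEquiv.ofFinrankEq _ _ (by simp)
  exact ⟨f ∘ₗ e.toLinearMap, hf.comp e.injective⟩

open Classical in
theorem pow_le_card_of_add_lt_sum_incidences {F K : Type*} [Field F] [Fintype F] [Field K]
    [Algebra F K] [IsAlgClosed K] {d k : ℕ} (hk : 1 ≤ k) (hkd : k ≤ d) {lam : ℝ} (hlam : 0 < lam)
    {P L : Finset (Submodule F K)} (hPk : ∀ p ∈ P, Module.finrank F p = k)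
    (hLk : ∀ ℓ ∈ L, Module.finrank F ℓ = k + 1)
    (h : 3 * (Fintype.card F : ℝ) ^ (d - k) * P.card +
      lam / 2 * (Fintype.card F : ℝ) ^ k * L.card <
        ∑ ℓ ∈ L, ((P.filter (· ≤ ℓ)).card : ℝ)) :
    (lam * Fintype.card F / (8 * ((d + 2 - k) * k : ℕ))) ^ ((d + 2 - k) * k) ≤ (P.card : ℝ) := by
  obtain ⟨P', hP', L', hL', hne, hPdeg, hLdeg⟩ :=
    exists_subsets_forall_le_degree (fun p ℓ => p ≤ ℓ) (by positivity) P L h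
  have hq : 2 ≤ Fintype.card F := Fintype.one_lt_card
  set q := Fintype.card F
  have hqR : (2 : ℝ) ≤ q := by exact_mod_cast hq
  have hN : 0 < (d + 2 - k) * k := Nat.mul_pos (by omega) hk
  have hpow : ∀ m : ℕ, (0 : ℝ) < (q : ℝ) ^ m := fun m => by positivity
  set N := (d + 2 - k) * k
  have hNR : (0 : ℝ) < N := by exact_mod_cast hN
  have key := pow_le_card_of_le_finrank_iSup (r := d + 2 - k) (e := ⌊lam * q / (8 * N)⌋₊) hk hne
    (fun p hp => hPk p (hP' hp)) (fun ℓ hℓ => hLk ℓ (hL' hℓ)) (fun ℓ hℓ => ?_) (fun p hp => ?_)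
  · calc (lam * q / (8 * N)) ^ N ≤ ((⌊lam * q / (8 * N)⌋₊ : ℝ) + 1) ^ N :=
        pow_le_pow_left₀ (by positivity) (Nat.lt_floor_add_one _).le _
      _ ≤ (P'.card : ℝ) := by exact_mod_cast key
      _ ≤ P.card := by exact_mod_cast Finset.card_le_card hP'
  · have he : (⌊lam * q / (8 * N)⌋₊ : ℝ) ≤ lam * q / (8 * N) := Nat.floor_le (by positivity)
    have hdeg := hLdeg ℓ hℓ
    have h1 : (N : ℝ) * ⌊lam * q / (8 * N)⌋₊ ≤ lam * q / 8 := by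
      calc _ ≤ (N : ℝ) * (lam * q / (8 * N)) := by gcongr
        _ = _ := by field_simp
    change N * ⌊lam * q / (8 * N)⌋₊ * q ^ k < (q - 1) * (P'.filter (· ≤ ℓ)).card
    rw [← Nat.cast_lt (α := ℝ)]
    push_cast [Nat.cast_sub (by omega : 1 ≤ q)]
    calc ((N * ⌊lam * q / (8 * N)⌋₊ * q ^ k : ℝ)) ≤ lam * q / 8 * q ^ k := by gcongr
      _ < (q / 2) * (lam / 2 * q ^ k) := by
        have := mul_pos (mul_pos hlam (by linarith : (0 : ℝ) < q)) (hpow k)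
        linarith
      _ ≤ (q - 1) * (lam / 2 * q ^ k) := by gcongr; linarith
      _ ≤ (q - 1) * (P'.filter (· ≤ ℓ)).card := by gcongr; linarith
  · by_contra! hlt
    have hcount := card_mul_le_pow_finrank_iSup (hPk p (hP' hp)) (L := L'.filter (p ≤ ·))
      (fun ℓ hℓ => hLk ℓ (hL' (Finset.mem_filter.1 hℓ).1)) fun ℓ hℓ => (Finset.mem_filter.1 hℓ).2
    have hcount := hcount.trans (Nat.pow_le_pow_right (by omega)
      (by omega : Module.finrank F (⨆ ℓ ∈ L'.filter (p ≤ ·), ℓ : Submodule F K) ≤ d + 1))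
    change _ * (q ^ (k + 1) - q ^ k) ≤ q ^ (d + 1) at hcount
    rw [← Nat.cast_le (α := ℝ)] at hcount
    push_cast [Nat.cast_sub (Nat.pow_le_pow_right (by omega : 0 < q) k.le_succ)] at hcount
    have hdeg := hPdeg p hp
    have h1 : (q : ℝ) ^ (k + 1) / 2 ≤ (q : ℝ) ^ (k + 1) - q ^ k := by
      have := mul_le_mul_of_nonneg_left hqR (hpow k).le
      rw [pow_succ]
      linarith
    have h2 : 3 * (q : ℝ) ^ (d - k) * (q ^ (k + 1) / 2) ≤ q ^ (d + 1) :=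
      (mul_le_mul hdeg h1 (by positivity) (by positivity)).trans hcount
    have h3 : (q : ℝ) ^ (d - k) * q ^ (k + 1) = q ^ (d + 1) := by
      rw [← pow_add]
      congr 1
      omega
    have := hpow (d + 1)
    linarith

theorem pow_le_ncard_of_forall_le_ncard_subset {F V : Type} [Field F] [Fintype F] [AddCommGroup V]
    [Module F V] [Module.Finite F V] {d k : ℕ} (hk : 1 ≤ k) (hkd : k ≤ d) {lam : ℝ}
    (hlam : 0 < lam) {L P : Set (Set V)} (hL : ∀ ℓ ∈ L, IsPlane F k ℓ)
    (hP : ∀ p ∈ P, IsPlane F (k - 1) p)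
    (hinc : ∀ ℓ ∈ L, lam * (Fintype.card F : ℝ) ^ k ≤ ({p ∈ P | p ⊆ ℓ}.ncard : ℝ))
    (h : 6 * (Fintype.card F : ℝ) ^ (d - k) * P.ncard <
      lam * (Fintype.card F : ℝ) ^ k * L.ncard) :
    (lam * Fintype.card F / (8 * ((d + 2 - k) * k : ℕ))) ^ ((d + 2 - k) * k) ≤ (P.ncard : ℝ) := by
  classical
  have : Finite V := Module.finite_of_finite F
  obtain ⟨φ, hφ⟩ := exists_injective_linearMap_algebraicClosure F (V × F)
  let Φ : Set V → Submodule F (AlgebraicClosure F) := fun A => (affineCone F A).map φ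
  have hrank : ∀ {m : ℕ} {A : Set V}, IsPlane F m A → Module.finrank F (Φ A) = m + 1 :=
    fun hA => (Submodule.equivMapOfInjective φ hφ _).finrank_eq.symm.trans
      hA.finrank_affineCone_and_mem_iff.1
  have hinj : ∀ {m : ℕ} {𝒜 : Set (Set V)}, (∀ A ∈ 𝒜, IsPlane F m A) → Set.InjOn Φ 𝒜 := fun h𝒜 =>
    (Submodule.map_injective_of_injective hφ).comp_injOn (affineCone_injOn h𝒜)
  have hPfin := P.toFinite
  have hLfin := L.toFinite
  have hPcard : ((hPfin.toFinset.image Φ).card : ℝ) = P.ncard := by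
    rw [Finset.card_image_of_injOn (by simpa using hinj hP), Set.ncard_eq_toFinset_card P hPfin]
  have hLinj : Set.InjOn Φ hLfin.toFinset := by simpa using hinj hL
  have hLcard : ((hLfin.toFinset.image Φ).card : ℝ) = L.ncard := by
    rw [Finset.card_image_of_injOn hLinj, Set.ncard_eq_toFinset_card L hLfin]
  rw [← hPcard]
  refine pow_le_card_of_add_lt_sum_incidences hk hkd hlam (L := hLfin.toFinset.image Φ) ?_ ?_ ?_
  · simp only [Finset.mem_image, Set.Finite.mem_toFinset]
    rintro _ ⟨p, hp, rfl⟩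
    rw [hrank (hP p hp)]
    omega
  · simp only [Finset.mem_image, Set.Finite.mem_toFinset]
    rintro _ ⟨ℓ, hℓ, rfl⟩
    exact hrank (hL ℓ hℓ)
  · have hsum : lam * (Fintype.card F : ℝ) ^ k * L.ncard ≤ ∑ ℓ ∈ hLfin.toFinset.image Φ,
        (((hPfin.toFinset.image Φ).filter (· ≤ ℓ)).card : ℝ) := by
      rw [Finset.sum_image hLinj, Set.ncard_eq_toFinset_card L hLfin, mul_comm, ← nsmul_eq_mul]
      refine Finset.card_nsmul_le_sum _ _ _ fun ℓ hℓ => ?_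
      rw [Set.Finite.mem_toFinset] at hℓ
      refine (hinc ℓ hℓ).trans ?_
      have hsub : {p ∈ P | p ⊆ ℓ} ⊆ P := Set.sep_subset _ _
      rw [← ((hinj hP).mono hsub).ncard_image, ← Set.ncard_coe_finset]
      refine Nat.cast_le.2 (Set.ncard_le_ncard ?_ (Finset.finite_toSet _))
      rintro _ ⟨p, ⟨hp, hle⟩, rfl⟩
      simp only [Finset.coe_filter, Finset.mem_image, Set.Finite.mem_toFinset, Set.mem_ofPred_eq]
      exact ⟨⟨p, hp, rfl⟩, Submodule.map_mono (affineCone_mono hle)⟩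
    rw [hPcard, hLcard]
    linarith

/-- **Proposition 4.1.** -/
theorem kplanes_hyperplanes_incidence_bound (d k : ℕ) (hk : 1 ≤ k) (hkd : k ≤ d)
    (γ lam : ℝ) (hγ0 : 0 < γ) (hγ1 : γ ≤ 1) (hlam0 : 0 < lam) (hlam1 : lam ≤ 1) :
    ∃ c : ℝ, 0 < c ∧
      ∀ (F : Type) [Field F] [Fintype F] (n : ℕ) (β : ℝ),
        0 ≤ β → β ≤ (k : ℝ) →
        ∀ (L P : Set (Set (Fin n → F))),
          (∀ ℓ ∈ L, IsPlane F k ℓ) →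
          (∀ p ∈ P, IsPlane F (k - 1) p) →
          (L.ncard : ℝ) ≥ γ * (Fintype.card F : ℝ) ^ (((k : ℝ) + 1) * ((d : ℝ) - k) + β) →
          (∀ ℓ ∈ L, ({p ∈ P | p ⊆ ℓ}.ncard : ℝ) ≥ lam * (Fintype.card F : ℝ) ^ (k : ℕ)) →
          (P.ncard : ℝ) ≥ c * (Fintype.card F : ℝ) ^ ((k : ℝ) * ((d : ℝ) - k + 1) + β) := by
  have hN : 0 < (d + 2 - k) * k := Nat.mul_pos (by omega) hk
  have hNR : (0 : ℝ) < ((d + 2 - k) * k : ℕ) := by exact_mod_cast hN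
  refine ⟨min (γ * lam / 6) ((lam / (8 * ((d + 2 - k) * k : ℕ))) ^ ((d + 2 - k) * k)),
    by positivity, ?_⟩
  intro F _ _ n β hβ0 hβk L P hL hP hLcard hinc
  by_contra! hlt
  have hq : (1 : ℝ) < Fintype.card F := by exact_mod_cast (Fintype.one_lt_card : 1 < Fintype.card F)
  have hcast : ((d - k : ℕ) : ℝ) = d - k := Nat.cast_sub hkd
  have hexp : (Fintype.card F : ℝ) ^ (d - k) *
      (Fintype.card F : ℝ) ^ ((k : ℝ) * ((d : ℝ) - k + 1) + β) =
      (Fintype.card F : ℝ) ^ k * (Fintype.card F : ℝ) ^ (((k : ℝ) + 1) * ((d : ℝ) - k) + β) := by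
    rw [← Real.rpow_natCast, ← Real.rpow_natCast, ← Real.rpow_add (by positivity),
      ← Real.rpow_add (by positivity), hcast]
    congr 1
    ring
  have hlarge := pow_le_ncard_of_forall_le_ncard_subset hk hkd hlam0 hL hP hinc (by
    calc 6 * (Fintype.card F : ℝ) ^ (d - k) * P.ncard
        < 6 * (Fintype.card F : ℝ) ^ (d - k) *
          (γ * lam / 6 * (Fintype.card F : ℝ) ^ ((k : ℝ) * ((d : ℝ) - k + 1) + β)) := by
          gcongr
          exact hlt.trans_le (by gcongr; exact min_le_left _ _)
      _ = γ * lam * ((Fintype.card F : ℝ) ^ (d - k) *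
          (Fintype.card F : ℝ) ^ ((k : ℝ) * ((d : ℝ) - k + 1) + β)) := by ring
      _ = lam * (Fintype.card F : ℝ) ^ k *
          (γ * (Fintype.card F : ℝ) ^ (((k : ℝ) + 1) * ((d : ℝ) - k) + β)) := by rw [hexp]; ring
      _ ≤ _ := by gcongr)
  refine hlt.not_ge (le_trans ?_ hlarge)
  rw [mul_div_right_comm lam, mul_pow]
  gcongr
  · exact min_le_right _ _
  · rw [← Real.rpow_natCast]
    refine Real.rpow_le_rpow_of_exponent_le hq.le ?_
    rw [Nat.cast_mul, Nat.cast_sub (by omega)]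
    push_cast
    linarith
end
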